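/- arXiv:1412.1686 — 3 statements merged into one kernel-verified Lean document; each statement's English description precedes it below -/
import Mathlib

section
/- Let F(x₀,…,xₙ) = a·x₀³ + x₀²·(b·x₁ + c·x₂) + G(x₁,…,xₙ) be a non-degenerate cubic form with integer coefficients (a,b,c ∈ ℤ, G ∈ ℤ[x₁,…,xₙ]₃) such that b ≠ 0. Assume that the line C = {x₂ = x₃ = ⋯ = xₙ = 0} ⊆ ℙⁿ(ℂ) is contained in V_F = {p : rk 𝓗_F(p) ≤ 2}. Then there exists T = (t_{ij})_{i,j=0,…,n} ∈ SL(n+1,ℚ) with t₀₀ = t₁₁ = 1, t₀ᵢ = tᵢ₀ = 0 for i = 1,…,n, and tᵢ₁ = 0 for i = 2,…,n, such that T·F = a·x₀³ + b·x₀²x₁ + c₁·x₁³ + R(x₂,…,xₙ), where c₁ ∈ ℤ and R ∈ ℚ[x₂,…,xₙ] is a cubic form. -/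
open MvPolynomial

noncomputable section

/-- The Hessian matrix of a multivariate polynomial `F`, evaluated at the point `x`. -/
def hess {m : ℕ} {R : Type*} [CommSemiring R] (F : MvPolynomial (Fin m) R)
    (x : Fin m → R) : Matrix (Fin m) (Fin m) R :=
  Matrix.of fun i j => eval x (pderiv i (pderiv j F))

/-- A polynomial is non-degenerate if the determinant of its Hessian is not
identically zero. -/
def nondeg {m : ℕ} {R : Type*} [CommRing R] (F : MvPolynomial (Fin m) R) : Prop :=
  ∃ x, (hess F x).det ≠ 0

/-- The substitution action of a matrix on a polynomial: `(T · F)(x) = F (T.mulVec x)`. -/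
def matAct {m : ℕ} {R : Type*} [CommSemiring R] (T : Matrix (Fin m) (Fin m) R)
    (F : MvPolynomial (Fin m) R) : MvPolynomial (Fin m) R :=
  bind₁ (fun i => ∑ j, C (T i j) * X j) F

/-- The projective hypersurface `{F = 0}` is smooth: the only common zero of the
partial derivatives of `F` is the origin. -/
def smoothHyp {m : ℕ} (F : MvPolynomial (Fin m) ℂ) : Prop :=
  ∀ x : Fin m → ℂ, (∀ i, eval x (pderiv i F) = 0) → x = 0

/-- The polynomial `a·x₀³ + x₀²·(∑ᵢ bᵢ xᵢ) + G(x₁, …, xₙ)`. -/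
def redPoly {m : ℕ} {R : Type*} [CommSemiring R] (a : R) (B : Fin m → R)
    (G : MvPolynomial (Fin m) R) : MvPolynomial (Fin (m + 1)) R :=
  C a * X 0 ^ 3 + X 0 ^ 2 * (∑ i, C (B i) * X i.succ) + rename Fin.succ G

/-- `(a, B, G)` is a reduced triple associated to `F`: `G` is a non-degenerate
cubic form and some `T ∈ SL(n+1, ℤ)` puts `F` in the reduced form `(a, B, G)`. -/
def IsReducedTriple {n : ℕ} (F : MvPolynomial (Fin (n + 1)) ℤ)
    (a : ℤ) (B : Fin n → ℤ) (G : MvPolynomial (Fin n) ℤ) : Prop :=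
  G.IsHomogeneous 3 ∧ nondeg G ∧
    ∃ T : Matrix (Fin (n + 1)) (Fin (n + 1)) ℤ, T.det = 1 ∧ matAct T F = redPoly a B G

/-- Equivalence of reduced triples over ℤ: `a = a'` and some `M ∈ SL(n, ℤ)`
carries `(B, G)` to `(B', G')`. -/
def TripleEquiv {n : ℕ} (a : ℤ) (B : Fin n → ℤ) (G : MvPolynomial (Fin n) ℤ)
    (a' : ℤ) (B' : Fin n → ℤ) (G' : MvPolynomial (Fin n) ℤ) : Prop :=
  a = a' ∧ ∃ M : Matrix (Fin n) (Fin n) ℤ, M.det = 1 ∧ B' = M.mulVec B ∧ G' = matAct M G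

theorem hess_map {m : ℕ} {R S : Type*} [CommSemiring R] [CommSemiring S] (φ : R →+* S)
    (F : MvPolynomial (Fin m) R) (x : Fin m → R) :
    hess (F.map φ) (φ ∘ x) = (hess F x).map φ := by
  ext i j
  simp [hess, pderiv_map, eval_map, eval₂_comp]

theorem pderiv_comm {σ R : Type*} [CommSemiring R] (i j : σ) (p : MvPolynomial σ R) :
    pderiv i (pderiv j p) = pderiv j (pderiv i p) := by
  ext d
  simp only [coeff_pderiv, Finsupp.add_apply, add_right_comm d]
  rcases eq_or_ne i j with rfl | hij
  · rfl
  · simp [Finsupp.single_eq_of_ne hij, Finsupp.single_eq_of_ne hij.symm]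
    ring

theorem hess_symm {m : ℕ} {R : Type*} [CommSemiring R] (F : MvPolynomial (Fin m) R)
    (x : Fin m → R) (i j : Fin m) : hess F x i j = hess F x j i := by
  simp [hess, pderiv_comm i j]

theorem Matrix.det_submatrix_eq_zero_of_rank_lt {K m n : Type*} [Field K] [Fintype m] [Fintype n]
    {k : ℕ} (A : Matrix m n K) (hA : A.rank < k) (r : Fin k → m) (c : Fin k → n) :
    (A.submatrix r c).det = 0 := by
  by_contra h
  have h₁ := Matrix.rank_of_det_ne_zero h
  have h₂ := A.rank_submatrix_le r c
  simp only [Fintype.card_fin] at h₁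
  omega

section Euler

variable {σ R : Type*} [Fintype σ] [DecidableEq σ] [CommSemiring R]

/-- Euler's identity at a standard basis vector. -/
theorem MvPolynomial.IsHomogeneous.eval_single_pderiv {p : MvPolynomial σ R} {d : ℕ}
    (hp : p.IsHomogeneous d) (k : σ) :
    eval (Pi.single k 1) (pderiv k p) = d * eval (Pi.single k 1) p := by
  have h := congrArg (eval (Pi.single k 1)) hp.sum_X_mul_pderiv
  simpa [Pi.single_apply] using h

end Euler

theorem MvPolynomial.IsHomogeneous.eq_zero_of_pderiv_eq_zero {σ R : Type*} [Fintype σ]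
    [CommRing R] [IsDomain R] [CharZero R] {p : MvPolynomial σ R} {d : ℕ}
    (hp : p.IsHomogeneous d) (hd : d ≠ 0) (h : ∀ i, pderiv i p = 0) : p = 0 := by
  have h := hp.sum_X_mul_pderiv
  simpa [*] using h

/-- A cubic form whose Hessian vanishes at the `k`-th basis vector does not depend on `X k`. -/
theorem pderiv_eq_zero_of_hess_eq_zero {m : ℕ} {R : Type*} [CommRing R] [IsDomain R] [CharZero R]
    {p : MvPolynomial (Fin m) R} (hp : p.IsHomogeneous 3) (k : Fin m)
    (h : hess p (Pi.single k 1) = 0) : pderiv k p = 0 := by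
  have hk := hp.pderiv (i := k)
  refine hk.eq_zero_of_pderiv_eq_zero two_ne_zero fun j => ?_
  have hj := hk.pderiv (i := j)
  refine hj.eq_zero_of_pderiv_eq_zero one_ne_zero fun i => ?_
  have hi : (pderiv i (pderiv j (pderiv k p))).totalDegree = 0 :=
    Nat.le_zero.1 hj.pderiv.totalDegree_le
  rw [totalDegree_eq_zero_iff_eq_C] at hi
  have he : eval (Pi.single k 1) (pderiv i (pderiv j (pderiv k p))) = 0 := by
    rw [pderiv_comm j k, pderiv_comm i k, hp.pderiv.pderiv.eval_single_pderiv]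
    have := congrFun (congrFun h i) j
    simp only [hess, Matrix.of_apply, Matrix.zero_apply] at this
    rw [this, mul_zero]
  rw [hi, eval_C] at he
  rw [hi, he, C_0]

theorem notMem_vars_of_pderiv_eq_zero {σ R : Type*} [CommRing R] [IsDomain R] [CharZero R]
    {p : MvPolynomial σ R} {k : σ} (h : pderiv k p = 0) : k ∉ p.vars := by
  classical
  rw [mem_vars_iff_mem_support]
  rintro ⟨d, hd, hk⟩
  have hle : Finsupp.single k 1 ≤ d := by
    rw [Finsupp.single_le_iff]
    exact Nat.one_le_iff_ne_zero.2 (Finsupp.mem_support_iff.1 hk)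
  have hc := coeff_pderiv (i := k) p (d - Finsupp.single k 1)
  rw [h, tsub_add_cancel_of_le hle, coeff_zero] at hc
  exact (mul_ne_zero (mem_support_iff.1 hd) (Nat.cast_add_one_ne_zero _)) hc.symm

section RedPoly

variable {m : ℕ} {R : Type*} [CommRing R] (a : R) (B : Fin m → R) (G : MvPolynomial (Fin m) R)
  (s : R) (y : Fin m → R)

theorem hess_redPoly_zero_zero :
    hess (redPoly a B G) (Fin.cons s y) 0 0 = 6 * a * s + 2 * ∑ i, B i * y i := by
  have h : pderiv 0 (rename Fin.succ G) = 0 :=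
    pderiv_eq_zero_of_notMem_vars fun hv => by
      obtain ⟨i, -, hi⟩ := mem_vars_rename _ _ hv
      exact Fin.succ_ne_zero i hi
  have h₂ : pderiv 0 (2 : MvPolynomial (Fin (m + 1)) R) = 0 := pderiv_C (a := 2)
  have h₃ : pderiv 0 (3 : MvPolynomial (Fin (m + 1)) R) = 0 := pderiv_C (a := 3)
  simp [hess, redPoly, h, h₂, h₃, Fin.succ_ne_zero]
  ring

theorem hess_redPoly_zero_succ (j : Fin m) :
    hess (redPoly a B G) (Fin.cons s y) 0 j.succ = 2 * s * B j := by
  have h : pderiv 0 (pderiv j.succ (rename Fin.succ G)) = 0 := by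
    rw [pderiv_rename (Fin.succ_injective m)]
    refine pderiv_eq_zero_of_notMem_vars fun hv => ?_
    obtain ⟨i, -, hi⟩ := mem_vars_rename _ _ hv
    exact Fin.succ_ne_zero i hi
  have h₀ (x : Fin m) :
      pderiv 0 (if x = j then C (B x) else 0 : MvPolynomial (Fin (m + 1)) R) = 0 := by
    split_ifs <;> simp
  simp [hess, redPoly, h, Pi.single_apply, (Fin.succ_ne_zero _).symm, h₀]
  ring

theorem hess_redPoly_succ_succ (i j : Fin m) :
    hess (redPoly a B G) (Fin.cons s y) i.succ j.succ = hess G y i j := by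
  simp [hess, redPoly, Pi.single_apply, (Fin.succ_ne_zero _).symm, apply_ite (pderiv i.succ),
    pderiv_rename (Fin.succ_injective m), eval_rename, Function.comp_def]

end RedPoly

/-- If the Hessian of a reduced form has rank at most two along the line through `e₀` and
`e_{k+1}`, then the Hessian of `G` at `e_k` is a multiple of `B Bᵀ`. -/
theorem sq_mul_hess_eq_of_rank_le_two {m : ℕ} {R : Type*} [CommRing R] [IsDomain R] [CharZero R]
    (a : R) (B : Fin m → R) (G : MvPolynomial (Fin m) R) (k : Fin m) (hB : B k ≠ 0)
    (h : ∀ (s : R) (r t : Fin 3 → Fin (m + 1)),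
      ((hess (redPoly a B G) (Fin.cons s (Pi.single k 1))).submatrix r t).det = 0) (i j : Fin m) :
    B k ^ 2 * hess G (Pi.single k 1) i j = hess G (Pi.single k 1) k k * B i * B j := by
  have hminor (s : R) (i j : Fin m) := h s ![0, k.succ, i.succ] ![0, k.succ, j.succ]
  simp only [Matrix.det_fin_three, Matrix.submatrix_apply, Matrix.cons_val,
    hess_symm _ _ (Fin.succ _) 0, hess_redPoly_zero_zero, hess_redPoly_zero_succ,
    hess_redPoly_succ_succ] at hminor
  simp only [Pi.single_apply, mul_ite, mul_one, mul_zero, Finset.sum_ite_eq',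
    Finset.mem_univ, if_true] at hminor
  set M := hess G (Pi.single k 1)
  have hrank (i j : Fin m) : M k k * M i j = M k j * M i k := by
    have h₀ := hminor 0 i j
    have : 2 * B k * (M k k * M i j - M k j * M i k) = 0 := by linear_combination h₀
    simpa [hB, sub_eq_zero] using this
  have hquad (i j : Fin m) :
      B k ^ 2 * M i j - B k * B j * M i k - B k * B i * M k j + B i * B j * M k k = 0 := by
    have h₁ := hminor 1 i j
    have : 4 * (B k ^ 2 * M i j - B k * B j * M i k - B k * B i * M k j + B i * B j * M k k)
        = 0 := by
      linear_combination -h₁ + (6 * a + 2 * B k) * hrank i j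
    simpa using this
  have hsymm (i : Fin m) : M i k = M k i := hess_symm _ _ _ _
  have hrow (i : Fin m) : B k * M k i = B i * M k k := by
    have : (B k * M k i - B i * M k k) ^ 2 = 0 := by
      have h₁ := hquad i i
      have h₂ := hrank i i
      simp only [hsymm] at h₁ h₂
      linear_combination M k k * h₁ - B k ^ 2 * h₂
    exact sub_eq_zero.1 (pow_eq_zero_iff two_ne_zero |>.1 this)
  have h₁ := hquad i j
  rw [hsymm] at h₁
  linear_combination h₁ + B j * hrow i + B i * hrow j

/-- A cubic form whose Hessian at `e_k` is `6g` times `v vᵀ` with `v k = 1` is, up to a form not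
involving `X k`, the cube of the linear form `∑ v i X i`. -/
theorem notMem_vars_sub_cube {m : ℕ} {R : Type*} [CommRing R] [IsDomain R] [CharZero R]
    {G : MvPolynomial (Fin m) R} (hG : G.IsHomogeneous 3) (k : Fin m) (v : Fin m → R)
    (hv : v k = 1) (g : R) (h : ∀ i j, hess G (Pi.single k 1) i j = 6 * g * v i * v j) :
    k ∉ (G - C g * (∑ i, C (v i) * X i) ^ 3).vars := by
  have hL : (∑ i, C (v i) * X i).IsHomogeneous 1 :=
    IsHomogeneous.sum _ _ _ fun i _ => isHomogeneous_C_mul_X _ _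
  have hL₃ := (isHomogeneous_C (Fin m) g).mul (hL.pow 3)
  refine notMem_vars_of_pderiv_eq_zero (pderiv_eq_zero_of_hess_eq_zero (hG.sub hL₃) k ?_)
  ext i j
  have h₃ : pderiv i (3 : MvPolynomial (Fin m) R) = 0 := pderiv_C (a := 3)
  have hd (i : Fin m) : pderiv i (∑ i, C (v i) * X i) = C (v i) := by
    simp [Pi.single_apply]
  have he : eval (Pi.single k 1) (∑ i, C (v i) * X i) = 1 := by
    simp [Pi.single_apply, hv]
  have := h i j
  simp only [hess, Matrix.of_apply] at this
  simp only [hess, Matrix.of_apply, map_sub, this, pderiv_pow, pderiv_mul, hd,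
    map_mul, eval_C, map_add, he, map_pow, Matrix.zero_apply]
  simp [h₃]
  ring

theorem exists_eq_add_cube {m : ℕ} {b c : ℤ} (hb : b ≠ 0) {B : Fin (m + 2) → ℤ}
    (hB : B = Fin.cons b (Fin.cons c 0)) {G : MvPolynomial (Fin (m + 2)) ℤ}
    (hG3 : G.IsHomogeneous 3)
    (hG : ∀ i j, B 0 ^ 2 * hess G (Pi.single 0 1) i j =
      hess G (Pi.single 0 1) 0 0 * B i * B j) :
    ∃ (g : ℤ) (R : MvPolynomial (Fin (m + 2)) ℚ), R.IsHomogeneous 3 ∧ 0 ∉ R.vars ∧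
      G.map (Int.castRingHom ℚ) = R + C (g : ℚ) * (X 0 + C ((c : ℚ) / b) * X 1) ^ 3 := by
  let g : ℤ := eval (Pi.single 0 1) G
  have hdiag : hess G (Pi.single 0 1) 0 0 = 6 * g := by
    simp only [hess, Matrix.of_apply, g]
    rw [hG3.pderiv.eval_single_pderiv, hG3.eval_single_pderiv]
    push_cast
    ring
  have hbQ : (b : ℚ) ≠ 0 := by exact_mod_cast hb
  have hvars : (0 : Fin (m + 2)) ∉
      (G.map (Int.castRingHom ℚ) - C (g : ℚ) * (∑ i, C ((B i : ℚ) / b) * X i) ^ 3).vars := by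
    refine notMem_vars_sub_cube (hG3.map _) 0 _ (by simp [hB, hbQ]) _ fun i j => ?_
    have h := hess_map (Int.castRingHom ℚ) G (Pi.single 0 1)
    rw [show (Int.castRingHom ℚ ∘ Pi.single 0 1 : Fin (m + 2) → ℚ) = Pi.single 0 1 by
      ext i; simp [Pi.single_apply]] at h
    rw [h, Matrix.map_apply]
    have hij := congrArg (Int.cast : ℤ → ℚ) (hG i j)
    rw [hdiag] at hij
    simp only [hB, Fin.cons_zero] at hij ⊢
    push_cast at hij
    rw [eq_intCast]
    field_simp
    linear_combination hij
  have hsum : ∑ i, C ((B i : ℚ) / b) * X i = X 0 + C ((c : ℚ) / b) * X (1 : Fin (m + 2)) := by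
    simp [hB, Fin.sum_univ_succ, hbQ]
  rw [hsum] at hvars
  have hL : (X 0 + C ((c : ℚ) / b) * X (1 : Fin (m + 2))).IsHomogeneous 1 :=
    (isHomogeneous_X _ _).add (isHomogeneous_C_mul_X _ _)
  exact ⟨g, _, (hG3.map _).sub ((isHomogeneous_C _ (g : ℚ)).mul (hL.pow 3)), hvars, by ring⟩

theorem sum_transvection_mul_X {m : ℕ} {R : Type*} [CommRing R] (i j k : Fin m) (r : R) :
    (∑ l, C (Matrix.transvection i j r k l) * X l : MvPolynomial (Fin m) R) =
      X k + if k = i then C r * X j else 0 := by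
  simp only [Matrix.transvection, Matrix.add_apply, C_add, add_mul, Finset.sum_add_distrib]
  congr 1
  · simp [Matrix.one_apply, apply_ite C, ite_mul]
  · rcases eq_or_ne k i with rfl | h
    · simp [Matrix.single_apply, apply_ite C, ite_mul]
    · simp [h, h.symm]

/-- Corollary 3.9. Let
`F = a·x₀³ + x₀²(b·x₁ + c·x₂) + G(x₁,…,xₙ)` be a non-degenerate integral cubic
form with `b ≠ 0`, and assume the line `{x₂ = ⋯ = xₙ = 0}` lies in `V_F`. Then
there is `T ∈ SL(n+1, ℚ)` of the stated shape with
`T·F = a·x₀³ + b·x₀²x₁ + c₁·x₁³ + R(x₂,…,xₙ)`, `c₁ ∈ ℤ`. -/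
theorem stmt5 {n : ℕ} (hn : 2 ≤ n) (a b c : ℤ) (hb : b ≠ 0)
    (G : MvPolynomial (Fin n) ℤ) (hG3 : G.IsHomogeneous 3)
    (F : MvPolynomial (Fin (n + 1)) ℤ)
    (hF : F = C a * X 0 ^ 3 + X 0 ^ 2 * (C b * X 1 + C c * X 2) + rename Fin.succ G)
    (hnd : nondeg F)
    (hline : ∀ x : Fin (n + 1) → ℂ, (∀ i : Fin (n + 1), 2 ≤ i.val → x i = 0) →
      (hess (F.map (Int.castRingHom ℂ)) x).rank ≤ 2) :
    ∃ T : Matrix (Fin (n + 1)) (Fin (n + 1)) ℚ, T.det = 1 ∧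
      T 0 0 = 1 ∧ T 1 1 = 1 ∧
      (∀ i : Fin (n + 1), i ≠ 0 → T 0 i = 0 ∧ T i 0 = 0) ∧
      (∀ i : Fin (n + 1), 2 ≤ i.val → T i 1 = 0) ∧
      ∃ (c₁ : ℤ) (R : MvPolynomial (Fin (n + 1)) ℚ), R.IsHomogeneous 3 ∧
        (∀ i ∈ R.vars, 2 ≤ i.val) ∧
        matAct T (F.map (Int.castRingHom ℚ)) =
          C (a : ℚ) * X 0 ^ 3 + C (b : ℚ) * X 0 ^ 2 * X 1 +
            C (c₁ : ℚ) * X 1 ^ 3 + R := by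
  obtain ⟨m, rfl⟩ := Nat.exists_eq_add_of_le' hn
  set B : Fin (m + 2) → ℤ := Fin.cons b (Fin.cons c 0) with hB
  have hF' : F = redPoly a B G := by
    simp [hF, redPoly, Fin.sum_univ_succ, hB]
  have hminor (s : ℤ) (r t : Fin 3 → Fin (m + 2 + 1)) :
      ((hess (redPoly a B G) (Fin.cons s (Pi.single 0 1))).submatrix r t).det = 0 := by
    have h := hline (Int.castRingHom ℂ ∘ Fin.cons s (Pi.single 0 1)) (by
      intro i hi
      obtain ⟨j, rfl⟩ := Fin.exists_succ_eq.2 (show i ≠ 0 by rintro rfl; simp at hi)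
      have hj : j ≠ 0 := by rintro rfl; simp at hi
      simp [hj])
    rw [hess_map, hF'] at h
    have := Matrix.det_submatrix_eq_zero_of_rank_lt _ (Nat.lt_succ_of_le h) r t
    rw [Matrix.submatrix_map, ← RingHom.mapMatrix_apply, ← RingHom.map_det] at this
    simpa using this
  have hG := sq_mul_hess_eq_of_rank_le_two a B G 0 (by simpa [hB]) hminor
  have hbQ : (b : ℚ) ≠ 0 := by exact_mod_cast hb
  obtain ⟨g, R₀, hR₀3, hR₀, hGR⟩ := exists_eq_add_cube hb hB hG3 hG
  have hRvars : ∀ i ∈ (rename Fin.succ R₀).vars, 2 ≤ i.val := by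
    intro i hi
    obtain ⟨j, hj, rfl⟩ := mem_vars_rename _ _ hi
    have : j ≠ 0 := by rintro rfl; exact hR₀ hj
    have := Fin.pos_iff_ne_zero.2 this
    simp only [Fin.lt_def, Fin.val_zero] at this
    simp; omega
  have h₁ : (1 : Fin (m + 2 + 1)).val = 1 := rfl
  have h₂ : (2 : Fin (m + 2 + 1)).val = 2 :=
    Nat.mod_eq_of_lt (show 2 < m + 2 + 1 by omega)
  have h₁₂ : (1 : Fin (m + 2 + 1)) ≠ 2 := fun h => by
    have := congrArg Fin.val h; omega
  have h₀₂ : (0 : Fin (m + 2 + 1)) ≠ 2 := fun h => by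
    have := congrArg Fin.val h; rw [h₂] at this; simp at this
  set T : Matrix (Fin (m + 2 + 1)) (Fin (m + 2 + 1)) ℚ :=
    Matrix.transvection 1 2 (-(c / b : ℚ)) with hT
  have hTsum (i : Fin (m + 2 + 1)) : (∑ j, C (T i j) * X j : MvPolynomial _ ℚ) =
      X i + if i = 1 then C (-(c / b : ℚ)) * X 2 else 0 := sum_transvection_mul_X _ _ _ _
  refine ⟨T, Matrix.det_transvection_of_ne _ _ h₁₂ _,
    ?_, ?_, ?_, ?_, g, rename Fin.succ R₀, hR₀3.rename_isHomogeneous, hRvars, ?_⟩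
  · simp [hT, Matrix.transvection]
  · simp [hT, Matrix.transvection, h₁₂.symm]
  · intro i hi
    simp [hT, Matrix.transvection, hi, hi.symm, h₀₂.symm]
  · intro i hi
    have : i ≠ 1 := by rintro rfl; omega
    simp [hT, Matrix.transvection, this, h₁₂.symm]
  · have hR : bind₁ (fun i => ∑ j, C (T i j) * X j) (rename Fin.succ R₀) = rename Fin.succ R₀ := by
      refine (hom_congr_vars (f₂ := RingHom.id _) ?_ ?_ rfl :
        (bind₁ (fun i => ∑ j, C (T i j) * X j)).toRingHom _ = _)
      · ext; simp
      · intro i hi _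
        have : i ≠ 1 := by rintro rfl; have := hRvars _ hi; omega
        simp [hTsum, this]
    have hbc : (C (b : ℚ) * C ((c : ℚ) / b) : MvPolynomial (Fin (m + 2 + 1)) ℚ) = C (c : ℚ) := by
      rw [← C_mul, mul_div_cancel₀ _ hbQ]
    have hFQ : F.map (Int.castRingHom ℚ) = C (a : ℚ) * X 0 ^ 3 +
        X 0 ^ 2 * (C (b : ℚ) * X 1 + C (c : ℚ) * X 2) +
          rename Fin.succ (G.map (Int.castRingHom ℚ)) := by
      simp [hF, map_rename]
    rw [hFQ, hGR, matAct]
    simp only [hTsum] at hR ⊢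
    simp only [map_add, map_mul, map_pow, rename_C, rename_X, hR, Fin.succ_zero_eq_one,
      show Fin.succ (1 : Fin (m + 2)) = 2 from rfl, bind₁_C_right, bind₁_X_right,
      if_neg h₁₂.symm, if_true, if_neg (show (0 : Fin (m + 2 + 1)) ≠ 1 by simp)]
    rw [C_neg]
    linear_combination -X 0 ^ 2 * X 2 * hbc
end
end

section
/- Let F(x,y) = a·x³ + b·x²y + c·y³ ∈ ℤ[x,y] be a binary cubic form with integer coefficients such that c ≠ 0. Then the set of pairs (a',b') ∈ ℤ² for which there exists T ∈ SL(2,ℤ) with (T·F)(x,y) = a'·x³ + b'·x²y + c·y³ is finite. -/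
open MvPolynomial

noncomputable section

/-- Coordinates of `α ^ n` in `1, α, α ^ 2` when `α ^ 3 + B * α + A = 0`. -/
def cubicCoord (A B : ℤ) : ℕ → Fin 3 → ℤ
  | 0 => ![1, 0, 0]
  | n + 1 => ![-A * cubicCoord A B n 2, cubicCoord A B n 0 - B * cubicCoord A B n 2,
      cubicCoord A B n 1]

lemma pow_eq_sum_cubicCoord {A B : ℤ} {α : ℂ} (hα : α ^ 3 + B * α + A = 0) (n : ℕ) :
    α ^ n = ∑ s : Fin 3, (cubicCoord A B n s : ℂ) * α ^ (s : ℕ) := by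
  induction n with
  | zero => simp [cubicCoord, Fin.sum_univ_three]
  | succ n ih =>
    rw [pow_succ, ih]
    simp only [cubicCoord, Fin.sum_univ_three, Matrix.cons_val]
    push_cast
    simp only [Fin.val_zero, Fin.val_one, Fin.val_two]
    linear_combination (cubicCoord A B n 2 : ℂ) * hα

lemma abs_cubicCoord_le (A B : ℤ) (n : ℕ) (s : Fin 3) :
    |cubicCoord A B n s| ≤ (1 + |A| + |B|) ^ n := by
  induction n generalizing s with
  | zero => fin_cases s <;> simp [cubicCoord]
  | succ n ih =>
    have h0 := ih 0
    have h1 := ih 1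
    have h2 := ih 2
    have hA := abs_nonneg A
    have hB := abs_nonneg B
    set D := (1 + |A| + |B|) ^ n
    have hD : 0 ≤ D := (abs_nonneg _).trans h0
    have hAD : |A| * |cubicCoord A B n 2| ≤ |A| * D := by gcongr
    have hBD : |B| * |cubicCoord A B n 2| ≤ |B| * D := by gcongr
    have hA0 : 0 ≤ |A| * D := by positivity
    have hB0 : 0 ≤ |B| * D := by positivity
    have hs : (1 + |A| + |B|) ^ (n + 1) = D + |A| * D + |B| * D := by
      rw [pow_succ]; ring
    rw [hs]
    fin_cases s
    · simp only [cubicCoord, Fin.mk_zero, Matrix.cons_val, abs_mul, abs_neg]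
      linarith
    · simp only [cubicCoord, Fin.mk_one, Matrix.cons_val]
      have := abs_sub (cubicCoord A B n 0) (B * cubicCoord A B n 2)
      rw [abs_mul] at this
      linarith
    · simp only [cubicCoord, Fin.reduceFinMk, Matrix.cons_val]
      linarith

/-- Siegel's lemma for a system with `30 * t` equations in `32 * t` unknowns. -/
lemma exists_int_solution_le {t : ℕ} (ht : 0 < t)
    (M : Matrix (Fin (10 * t) × Fin 3) (Fin (16 * t) × Fin 2) ℤ) {E : ℝ} (hE : 1 ≤ E)
    (hM : ∀ i j, |(M i j : ℝ)| ≤ E) :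
    ∃ v : Fin (16 * t) × Fin 2 → ℤ, v ≠ 0 ∧ M.mulVec v = 0 ∧
      ∀ j, |(v j : ℝ)| ≤ (32 * t * E) ^ 15 := by
  let := Matrix.seminormedAddCommGroup (m := Fin (10 * t) × Fin 3)
    (n := Fin (16 * t) × Fin 2) (α := ℤ)
  obtain ⟨v, hv0, hv, hle⟩ := Int.Matrix.exists_ne_zero_int_vec_norm_le M
    (by simp; omega) (by simp; omega)
  refine ⟨v, hv0, hv, fun j ↦ ?_⟩
  have h1 : ‖M‖ ≤ E := (Matrix.norm_le_iff (by linarith)).2 fun i j ↦ by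
    simpa [Int.norm_eq_abs] using hM i j
  have h2 : |(v j : ℝ)| ≤ ‖v‖ := by
    have := norm_le_pi_norm v j
    rwa [Int.norm_eq_abs] at this
  refine h2.trans (hle.trans ?_)
  have ht' : (t : ℝ) ≠ 0 := by positivity
  have he : ((Fintype.card (Fin (10 * t) × Fin 3) : ℕ) : ℝ) /
      ((Fintype.card (Fin (16 * t) × Fin 2) : ℕ) - (Fintype.card (Fin (10 * t) × Fin 3) : ℕ))
      = ((15 : ℕ) : ℝ) := by
    simp only [Fintype.card_prod, Fintype.card_fin]
    push_cast
    rw [div_eq_iff (by ring_nf; positivity)]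
    ring
  rw [he, Real.rpow_natCast]
  have hmax : max 1 ‖M‖ ≤ E := max_le hE h1
  have : ((Fintype.card (Fin (16 * t) × Fin 2) : ℕ) : ℝ) = 32 * t := by
    simp only [Fintype.card_prod, Fintype.card_fin]
    push_cast
    ring
  rw [this]
  gcongr

namespace Polynomial

/-- Polynomials `P₀, P₁` of degree less than `16 * t` with small integer coefficients such that
`P₀ + α * P₁` vanishes to order `10 * t` at `α`. -/
lemma exists_auxiliary {A B : ℤ} {α : ℂ} (hα : α ^ 3 + B * α + A = 0) :
    ∃ K : ℝ, 1 ≤ K ∧ ∀ t : ℕ, 0 < t → ∃ P₀ P₁ : ℤ[X], (P₀ ≠ 0 ∨ P₁ ≠ 0) ∧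
      P₀.natDegree < 16 * t ∧ P₁.natDegree < 16 * t ∧
      (∀ i, |(P₀.coeff i : ℝ)| ≤ K ^ t) ∧ (∀ i, |(P₁.coeff i : ℝ)| ≤ K ^ t) ∧
      ∀ k < 10 * t, aeval α (hasseDeriv k P₀) + α * aeval α (hasseDeriv k P₁) = 0 := by
  set D : ℝ := 1 + |(A : ℝ)| + |(B : ℝ)| with hD
  have hD1 : 1 ≤ D := by
    have := abs_nonneg (A : ℝ)
    have := abs_nonneg (B : ℝ)
    linarith
  refine ⟨(2 ^ 32 * 2 ^ 16 * D ^ 17) ^ 15,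
    one_le_pow₀ (one_le_mul_of_one_le_of_one_le (by norm_num) (one_le_pow₀ hD1)),
    fun t ht ↦ ?_⟩
  let M : Matrix (Fin (10 * t) × Fin 3) (Fin (16 * t) × Fin 2) ℤ :=
    Matrix.of fun r j ↦ ((j.1 : ℕ).choose r.1 : ℤ) *
      cubicCoord A B ((j.1 : ℕ) - (r.1 : ℕ) + (j.2 : ℕ)) r.2
  have hM : ∀ i j, |(M i j : ℝ)| ≤ 2 ^ (16 * t) * D ^ (17 * t) := by
    intro i j
    simp only [M, Matrix.of_apply, Int.cast_mul, abs_mul]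
    gcongr
    · have h1 : (j.1 : ℕ).choose i.1 ≤ 2 ^ (16 * t) :=
        (Nat.choose_le_two_pow _ _).trans (Nat.pow_le_pow_right (by norm_num) j.1.2.le)
      simp only [Int.cast_natCast, Nat.abs_cast]
      exact_mod_cast h1
    · have h1 := abs_cubicCoord_le A B ((j.1 : ℕ) - (i.1 : ℕ) + (j.2 : ℕ)) i.2
      have h2 : |(cubicCoord A B ((j.1 : ℕ) - (i.1 : ℕ) + (j.2 : ℕ)) i.2 : ℝ)| ≤
          D ^ ((j.1 : ℕ) - (i.1 : ℕ) + (j.2 : ℕ)) := by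
        rw [hD]; exact_mod_cast h1
      refine h2.trans (pow_le_pow_right₀ hD1 ?_)
      have := j.1.2
      have := j.2.2
      omega
  obtain ⟨v, hv0, hv, hle⟩ := exists_int_solution_le ht M
    (one_le_mul_of_one_le_of_one_le (one_le_pow₀ (by norm_num)) (one_le_pow₀ hD1)) hM
  let P : Fin 2 → ℤ[X] := fun e ↦ ∑ j : Fin (16 * t), monomial (j : ℕ) (v (j, e))
  have hcoeff : ∀ e i, (P e).coeff i = if h : i < 16 * t then v (⟨i, h⟩, e) else 0 := by
    intro e i
    simp only [P, finsetSum_coeff, coeff_monomial]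
    split_ifs with h
    · rw [Finset.sum_eq_single ⟨i, h⟩] <;> simp +contextual [Fin.ext_iff]
    · exact Finset.sum_eq_zero fun j _ ↦ if_neg (by have := j.2; omega)
  have hdeg : ∀ e, (P e).natDegree < 16 * t := by
    intro e
    have : (P e).natDegree ≤ 16 * t - 1 := natDegree_le_iff_coeff_eq_zero.2 fun N hN ↦ by
      rw [hcoeff, dif_neg (by omega)]
    omega
  have hbound : ∀ e i, |((P e).coeff i : ℝ)| ≤ ((2 ^ 32 * 2 ^ 16 * D ^ 17) ^ 15) ^ t := by
    intro e i
    rw [hcoeff]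
    split_ifs with h
    · refine (hle _).trans ?_
      rw [pow_right_comm]
      have h1 : (32 * t : ℝ) ≤ (2 ^ 32) ^ t := by
        rw [← pow_mul]
        exact_mod_cast (Nat.lt_two_pow_self (n := 32 * t)).le
      have h2 : (2 : ℝ) ^ (16 * t) * D ^ (17 * t) = (2 ^ 16 * D ^ 17) ^ t := by
        rw [mul_pow, pow_mul, pow_mul]
      rw [h2, mul_assoc ((2 : ℝ) ^ 32), mul_pow ((2 : ℝ) ^ 32)]
      gcongr
    · simp; positivity
  refine ⟨P 0, P 1, ?_, hdeg 0, hdeg 1, hbound 0, hbound 1, fun k hk ↦ ?_⟩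
  · by_contra! h
    apply hv0
    ext ⟨j, e⟩
    have h0 : P e = 0 := by fin_cases e; exacts [h.1, h.2]
    have := hcoeff e j
    rw [dif_pos j.2, h0] at this
    simpa using this.symm
  · have hP : ∀ e, aeval α (hasseDeriv k (P e)) =
        ∑ j : Fin (16 * t), ((j : ℕ).choose k : ℂ) * v (j, e) * α ^ ((j : ℕ) - k) := by
      intro e
      simp [P, map_sum, hasseDeriv_monomial, aeval_monomial]
    have hrow : ∀ s : Fin 3, ∑ j : Fin (16 * t), (((j : ℕ).choose k : ℂ) *
        cubicCoord A B ((j : ℕ) - k) s * v (j, 0) + ((j : ℕ).choose k : ℂ) *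
        cubicCoord A B ((j : ℕ) - k + 1) s * v (j, 1)) = 0 := by
      intro s
      have := congrFun hv (⟨k, hk⟩, s)
      simp only [Matrix.mulVec, dotProduct, M, Matrix.of_apply, Pi.zero_apply,
        Fintype.sum_prod_type, Fin.sum_univ_two] at this
      exact_mod_cast this
    rw [hP, hP, Finset.mul_sum, ← Finset.sum_add_distrib]
    calc _ = ∑ j : Fin (16 * t), ∑ s : Fin 3, α ^ (s : ℕ) * (((j : ℕ).choose k : ℂ) *
        cubicCoord A B ((j : ℕ) - k) s * v (j, 0) + ((j : ℕ).choose k : ℂ) *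
        cubicCoord A B ((j : ℕ) - k + 1) s * v (j, 1)) := by
          refine Finset.sum_congr rfl fun j _ ↦ ?_
          have h1 := pow_eq_sum_cubicCoord hα ((j : ℕ) - k)
          have h2 := pow_eq_sum_cubicCoord hα ((j : ℕ) - k + 1)
          rw [Fin.sum_univ_three] at h1 h2 ⊢
          linear_combination ((j : ℕ).choose k : ℂ) * v (j, 0) * h1 +
            ((j : ℕ).choose k : ℂ) * v (j, 1) * h2
      _ = 0 := by
          rw [Finset.sum_comm]
          exact Finset.sum_eq_zero fun s _ ↦ by rw [← Finset.mul_sum, hrow, mul_zero]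

lemma natDegree_mul_le_of_pow_dvd_map {f g : ℚ[X]} (hf : Irreducible f) {α : ℂ}
    (hα : aeval α f = 0) (hg : g ≠ 0) {h : ℕ}
    (hdvd : (X - C α) ^ h ∣ g.map (algebraMap ℚ ℂ)) : f.natDegree * h ≤ g.natDegree := by
  induction h generalizing g with
  | zero => simp
  | succ h ih =>
    have hfg : f ∣ g := by
      have hroot : aeval α g = 0 := by
        rw [← eval_map_algebraMap, ← IsRoot, ← dvd_iff_isRoot]
        exact (dvd_pow_self _ h.succ_ne_zero).trans hdvd
      have h1 := minpoly.dvd ℚ α hroot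
      have h2 : Associated (minpoly ℚ α) f :=
        (minpoly.irreducible (IsAlgebraic.isIntegral ⟨f, hf.ne_zero, hα⟩)).associated_of_dvd hf
          (minpoly.dvd ℚ α hα)
      exact h2.symm.dvd.trans h1
    obtain ⟨g', rfl⟩ := hfg
    have hg' : g' ≠ 0 := right_ne_zero_of_mul hg
    have hroot : (f.map (algebraMap ℚ ℂ)).IsRoot α := by
      rw [IsRoot, eval_map_algebraMap, hα]
    obtain ⟨u, hu⟩ := dvd_iff_isRoot.2 hroot
    have hsep : (f.map (algebraMap ℚ ℂ)).Separable := hf.separable.map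
    have hXu : IsCoprime (X - C α) u := by
      rw [hu] at hsep
      exact hsep.isCoprime
    rw [Polynomial.map_mul, hu, pow_succ', mul_assoc] at hdvd
    have h1 := (mul_dvd_mul_iff_left (X_sub_C_ne_zero α)).1 hdvd
    have h2 := ih hg' ((hXu.pow_left (m := h)).dvd_of_dvd_mul_left h1)
    rw [natDegree_mul hf.ne_zero hg', mul_add, mul_one]
    omega

lemma exists_eq_C_mul_of_wronskian_eq_zero {P Q : ℚ[X]} (hPQ : P ≠ 0 ∨ Q ≠ 0)
    (hw : wronskian P Q = 0) : ∃ g : ℚ[X], ∃ a b : ℚ, P = g * C a ∧ Q = g * C b := by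
  classical
  have hg : EuclideanDomain.gcd P Q ≠ 0 := by
    rw [Ne, EuclideanDomain.gcd_eq_zero_iff]; tauto
  obtain ⟨p, hp⟩ := EuclideanDomain.gcd_dvd_left P Q
  obtain ⟨q, hq⟩ := EuclideanDomain.gcd_dvd_right P Q
  set g := EuclideanDomain.gcd P Q with hgdef
  have hcop : IsCoprime p q := by
    refine ⟨EuclideanDomain.gcdA P Q, EuclideanDomain.gcdB P Q, mul_left_cancel₀ hg ?_⟩
    have := EuclideanDomain.gcd_eq_gcd_ab P Q
    rw [← hgdef] at this
    linear_combination -this - EuclideanDomain.gcdA P Q * hp - EuclideanDomain.gcdB P Q * hq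
  have hw' : wronskian p q = 0 := by
    have : g ^ 2 * wronskian p q = wronskian P Q := by
      rw [hp, hq]; simp only [wronskian, derivative_mul]; ring
    rw [hw] at this
    exact (mul_eq_zero.1 this).resolve_left (pow_ne_zero 2 hg)
  obtain ⟨h1, h2⟩ := hcop.wronskian_eq_zero_iff.1 hw'
  exact ⟨g, p.coeff 0, q.coeff 0, by rw [← eq_C_of_derivative_eq_zero h1, hp],
    by rw [← eq_C_of_derivative_eq_zero h2, hq]⟩

lemma X_sub_C_pow_dvd_iff_hasseDeriv {R : Type*} [CommRing R] {f : R[X]} {r : R} {n : ℕ} :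
    (X - C r) ^ n ∣ f ↔ ∀ k < n, (hasseDeriv k f).eval r = 0 := by
  rw [X_sub_C_pow_dvd_iff, ← taylor_apply, X_pow_dvd_iff]
  simp [taylor_coeff]

lemma hasseDeriv_map {R S : Type*} [Semiring R] [Semiring S] (φ : R →+* S) (k : ℕ) (p : R[X]) :
    hasseDeriv k (p.map φ) = (hasseDeriv k p).map φ := by
  ext n
  simp [hasseDeriv_coeff]

lemma wronskian_ne_zero_of_hasseDeriv {f : ℚ[X]} (hf : Irreducible f) {α : ℂ}
    (hα : aeval α f = 0) (hdeg : 1 < f.natDegree) {P Q : ℤ[X]} (hPQ : P ≠ 0 ∨ Q ≠ 0) {h : ℕ}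
    (hP : P.natDegree < f.natDegree * h) (hQ : Q.natDegree < f.natDegree * h)
    (hvan : ∀ k < h, aeval α (hasseDeriv k P) + α * aeval α (hasseDeriv k Q) = 0) :
    wronskian P Q ≠ 0 := by
  intro hw
  set φ := Int.castRingHom ℚ
  have hinj : Function.Injective φ := RingHom.injective_int φ
  have hmap : P.map φ ≠ 0 ∨ Q.map φ ≠ 0 := by
    simpa only [Ne, Polynomial.map_eq_zero_iff hinj] using hPQ
  have hw' : wronskian (P.map φ) (Q.map φ) = 0 := by
    have : (wronskian P Q).map φ = wronskian (P.map φ) (Q.map φ) := by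
      simp [wronskian, derivative_map]
    rw [← this, hw, Polynomial.map_zero]
  obtain ⟨g, a, b, hPg, hQg⟩ := exists_eq_C_mul_of_wronskian_eq_zero hmap hw'
  have hg : g ≠ 0 := by
    rintro rfl
    simp_all
  have hirr : (a : ℂ) + α * b ≠ 0 := by
    intro h0
    by_cases hb : b = 0
    · have ha : a = 0 := by simpa [hb] using h0
      simp_all
    · have hα' : α = ((-a / b : ℚ) : ℂ) := by
        have : (b : ℂ) ≠ 0 := by exact_mod_cast hb
        push_cast
        field_simp
        linear_combination h0
      have hroot : f.IsRoot (-a / b) := by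
        rw [hα', ← eq_ratCast (algebraMap ℚ ℂ), aeval_algebraMap_apply] at hα
        simpa using hα
      have : f.natDegree = 1 :=
        natDegree_eq_of_degree_eq_some (degree_eq_one_of_irreducible_of_root hf hroot)
      omega
  have hdvd : (X - C α) ^ h ∣ g.map (algebraMap ℚ ℂ) := by
    have key : (X - C α) ^ h ∣ C ((a : ℂ) + α * b) * g.map (algebraMap ℚ ℂ) := by
      have hPC : P.map (algebraMap ℤ ℂ) = g.map (algebraMap ℚ ℂ) * C (a : ℂ) := by
        have := congrArg (Polynomial.map (algebraMap ℚ ℂ)) hPg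
        rw [Polynomial.map_map,
          RingHom.ext_int ((algebraMap ℚ ℂ).comp φ) (algebraMap ℤ ℂ)] at this
        simpa using this
      have hQC : Q.map (algebraMap ℤ ℂ) = g.map (algebraMap ℚ ℂ) * C (b : ℂ) := by
        have := congrArg (Polynomial.map (algebraMap ℚ ℂ)) hQg
        rw [Polynomial.map_map,
          RingHom.ext_int ((algebraMap ℚ ℂ).comp φ) (algebraMap ℤ ℂ)] at this
        simpa using this
      have heq : C ((a : ℂ) + α * b) * g.map (algebraMap ℚ ℂ) =
          P.map (algebraMap ℤ ℂ) + α • Q.map (algebraMap ℤ ℂ) := by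
        rw [hPC, hQC, smul_eq_C_mul, C_add, C_mul]; ring
      rw [heq, X_sub_C_pow_dvd_iff_hasseDeriv]
      intro k hk
      have := hvan k hk
      rw [map_add, map_smul, hasseDeriv_map, hasseDeriv_map, eval_add, eval_smul,
        eval_map_algebraMap, eval_map_algebraMap, smul_eq_mul, this]
    exact (IsUnit.dvd_mul_left (isUnit_C.2 (isUnit_iff_ne_zero.2 hirr))).1 key
  have h1 := natDegree_mul_le_of_pow_dvd_map hf hα hg hdvd
  rcases hPQ with h0 | h0
  · have h2 : (P.map φ).natDegree = P.natDegree := natDegree_map_eq_of_injective hinj _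
    have ha : a ≠ 0 := by
      rintro rfl
      rw [C_0, mul_zero, Polynomial.map_eq_zero_iff hinj] at hPg
      exact h0 hPg
    rw [hPg, natDegree_mul_C ha] at h2
    omega
  · have h2 : (Q.map φ).natDegree = Q.natDegree := natDegree_map_eq_of_injective hinj _
    have ha : b ≠ 0 := by
      rintro rfl
      rw [C_0, mul_zero, Polynomial.map_eq_zero_iff hinj] at hQg
      exact h0 hQg
    rw [hQg, natDegree_mul_C ha] at h2
    omega

/-- The power of the linear form of a rational zero divides the leading coefficient. -/
lemma den_pow_dvd_leadingCoeff {W : ℤ[X]} {x : ℚ} {n : ℕ}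
    (h : (X - C x) ^ n ∣ W.map (Int.castRingHom ℚ)) : (x.den : ℤ) ^ n ∣ W.leadingCoeff := by
  set L : ℤ[X] := C (x.den : ℤ) * X + C (-x.num) with hL
  have hcop : IsCoprime (x.den : ℤ) x.num := by
    rw [Int.isCoprime_iff_gcd_eq_one, Int.gcd_comm]
    simpa [Int.gcd] using x.reduced
  have hprim : L.IsPrimitive := by
    intro r hr
    rw [C_dvd_iff_dvd_coeff] at hr
    have h0 := hr 0
    have h1 := hr 1
    simp only [hL, coeff_add, coeff_C_mul, coeff_X_one, coeff_X_zero, coeff_C_zero, mul_zero,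
      zero_add, dvd_neg, mul_one, coeff_C_of_ne_zero one_ne_zero, add_zero] at h0 h1
    exact hcop.isUnit_of_dvd' h1 h0
  have hprimpow : (L ^ n).IsPrimitive := by
    induction n with
    | zero => simp
    | succ n ih => rw [pow_succ]; exact (ih ((pow_dvd_pow _ n.le_succ).trans h)).mul hprim
  have hLmap : L.map (Int.castRingHom ℚ) = C (x.den : ℚ) * (X - C x) := by
    simp only [hL, Polynomial.map_add, Polynomial.map_mul, map_C, map_X, mul_sub, ← C_mul]
    simp [Rat.den_mul_eq_num, sub_eq_add_neg]
  have hdvd : L ^ n ∣ W := by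
    rw [IsPrimitive.Int.dvd_iff_map_cast_dvd_map_cast _ _ hprimpow, Polynomial.map_pow, hLmap,
      mul_pow]
    refine (IsUnit.mul_left_dvd ?_).2 h
    exact (isUnit_C.2 (isUnit_iff_ne_zero.2 (by exact_mod_cast x.den_ne_zero))).pow n
  have hlead : L.leadingCoeff = x.den := by
    rw [hL, leadingCoeff_linear (by simp)]
  obtain ⟨V, rfl⟩ := hdvd
  rw [leadingCoeff_mul, leadingCoeff_pow, hlead]
  exact dvd_mul_right _ _

lemma abs_coeff_wronskian_le {P Q : ℤ[X]} {d i : ℕ} {K : ℝ} (hP : P.natDegree < d)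
    (hQ : Q.natDegree < d) (hPK : ∀ j, |(P.coeff j : ℝ)| ≤ K) (hQK : ∀ j, |(Q.coeff j : ℝ)| ≤ K)
    (hi : i < 2 * d) : |((wronskian P Q).coeff i : ℝ)| ≤ (2 * d * K) ^ 2 := by
  have hK : 0 ≤ K := (abs_nonneg _).trans (hPK 0)
  have hder : ∀ {R : ℤ[X]}, R.natDegree < d → (∀ j, |(R.coeff j : ℝ)| ≤ K) →
      ∀ j, |((derivative R).coeff j : ℝ)| ≤ d * K := by
    intro R hR hRK j
    rw [coeff_derivative]
    by_cases hj : j + 1 < d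
    · push_cast
      rw [abs_mul, mul_comm (d : ℝ)]
      have h1 : |(j : ℝ) + 1| ≤ d := by
        rw [abs_of_nonneg (by positivity)]
        exact_mod_cast hj.le
      exact mul_le_mul (hRK _) h1 (abs_nonneg _) hK
    · rw [coeff_eq_zero_of_natDegree_lt (by omega)]
      simp only [zero_mul, Int.cast_zero, abs_zero]
      positivity
  have hmul : ∀ {R S : ℤ[X]} {K₁ K₂ : ℝ}, 0 ≤ K₁ → 0 ≤ K₂ → (∀ j, |(R.coeff j : ℝ)| ≤ K₁) →
      (∀ j, |(S.coeff j : ℝ)| ≤ K₂) → |((R * S).coeff i : ℝ)| ≤ 2 * d * (K₁ * K₂) := by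
    intro R S K₁ K₂ h1 h2 hR hS
    rw [coeff_mul]
    push_cast
    refine (Finset.abs_sum_le_sum_abs _ _).trans ?_
    refine (Finset.sum_le_card_nsmul _ _ (K₁ * K₂) fun j _ ↦ ?_).trans ?_
    · rw [abs_mul]
      exact mul_le_mul (hR _) (hS _) (abs_nonneg _) h1
    · rw [Finset.Nat.card_antidiagonal, nsmul_eq_mul]
      have : ((i + 1 : ℕ) : ℝ) ≤ 2 * d := by exact_mod_cast hi
      gcongr
  have hdK : 0 ≤ d * K := by positivity
  have h1 := hmul hK hdK hPK (hder hQ hQK)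
  have h2 := hmul hdK hK (hder hP hPK) hQK
  rw [wronskian, coeff_sub, Int.cast_sub]
  refine (abs_sub _ _).trans ((add_le_add h1 h2).trans (le_of_eq ?_))
  ring

lemma norm_eval_le {f : ℂ[X]} {d : ℕ} {K M : ℝ} {x : ℂ} (hf : f.natDegree < d)
    (hK : ∀ i, ‖f.coeff i‖ ≤ K) (hM : 1 ≤ M) (hx : ‖x‖ ≤ M) : ‖f.eval x‖ ≤ d * K * M ^ d := by
  have hK0 : 0 ≤ K := (norm_nonneg _).trans (hK 0)
  rw [eval_eq_sum_range' hf]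
  refine (norm_sum_le_of_le (f := fun i ↦ f.coeff i * x ^ i) (n := fun _ ↦ K * M ^ d) _
    fun i hi ↦ ?_).trans ?_
  · rw [norm_mul, norm_pow]
    have h1 : ‖x‖ ^ i ≤ M ^ d := (pow_le_pow_left₀ (norm_nonneg x) hx i).trans
      (pow_le_pow_right₀ hM (Finset.mem_range.1 hi).le)
    exact mul_le_mul (hK i) h1 (by positivity) hK0
  · simp [mul_assoc]

lemma norm_aeval_hasseDeriv_le {P : ℤ[X]} {d : ℕ} {K M : ℝ} {x : ℂ} (hP : P.natDegree < d)
    (hK : ∀ i, |(P.coeff i : ℝ)| ≤ K) (hM : 1 ≤ M) (hx : ‖x‖ ≤ M) (k : ℕ) :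
    ‖aeval x (hasseDeriv k P)‖ ≤ d * (2 ^ d * K) * M ^ d := by
  have hK0 : 0 ≤ K := (abs_nonneg _).trans (hK 0)
  rw [← eval_map_algebraMap]
  refine norm_eval_le ?_ (fun i ↦ ?_) hM hx
  · have h1 := natDegree_hasseDeriv_le P k
    have h2 := natDegree_map_le (f := algebraMap ℤ ℂ) (p := hasseDeriv k P)
    omega
  · rw [coeff_map, hasseDeriv_coeff]
    by_cases hi : i + k < d
    · have h1 : ((i + k).choose k : ℝ) ≤ 2 ^ d := by
        exact_mod_cast (Nat.choose_le_two_pow _ _).trans (Nat.pow_le_pow_right (by norm_num) hi.le)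
      have h2 := hK (i + k)
      simp only [algebraMap_int_eq, eq_intCast, Int.cast_mul, Int.cast_natCast, norm_mul,
        Complex.norm_natCast, Complex.norm_intCast]
      gcongr
    · rw [coeff_eq_zero_of_natDegree_lt (by omega)]
      simp only [mul_zero, map_zero, norm_zero]
      positivity

/-- Taylor's formula at a zero of high order. -/
lemma norm_eval_hasseDeriv_le_of_vanishing {f : ℂ[X]} {d h k : ℕ} {K : ℝ} {α x : ℂ}
    (hf : f.natDegree < d) (hK : ∀ i, ‖(hasseDeriv i f).eval α‖ ≤ K)
    (hvan : ∀ i < h, (hasseDeriv i f).eval α = 0) (hx : ‖α - x‖ ≤ 1) :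
    ‖(hasseDeriv k f).eval x‖ ≤ d * (2 ^ d * K) * ‖α - x‖ ^ (h - k) := by
  have hK0 : 0 ≤ K := (norm_nonneg _).trans (hK 0)
  have key : (hasseDeriv k f).eval x = (hasseDeriv k (taylor α f)).eval (x - α) := by
    rw [← taylor_coeff, ← taylor_coeff, taylor_taylor, sub_add_cancel]
  have hdeg : (hasseDeriv k (taylor α f)).natDegree < d := by
    have := natDegree_hasseDeriv_le (taylor α f) k
    rw [natDegree_taylor] at this
    omega
  rw [key, eval_eq_sum_range' hdeg]
  refine (norm_sum_le_of_le (n := fun _ ↦ 2 ^ d * K * ‖α - x‖ ^ (h - k)) _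
    fun i hi ↦ ?_).trans ?_
  · rw [hasseDeriv_coeff, taylor_coeff, norm_mul, norm_mul, norm_pow, Complex.norm_natCast,
      norm_sub_rev x α]
    by_cases hih : i + k < h
    · rw [hvan _ hih]
      simp only [norm_zero, mul_zero, zero_mul]
      positivity
    by_cases hid : i + k < d
    · have h1 : ((i + k).choose k : ℝ) ≤ 2 ^ d := by
        exact_mod_cast (Nat.choose_le_two_pow _ _).trans (Nat.pow_le_pow_right (by norm_num) hid.le)
      have h2 : ‖α - x‖ ^ i ≤ ‖α - x‖ ^ (h - k) :=
        pow_le_pow_of_le_one (norm_nonneg _) hx (by omega)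
      have h3 := hK (i + k)
      gcongr
    · rw [hasseDeriv_eq_zero_of_lt_natDegree _ _ (by omega)]
      simp only [eval_zero, norm_zero, mul_zero, zero_mul]
      positivity
  · simp [mul_assoc]

lemma exists_hasseDeriv_eval_ne_zero {P Q : ℤ[X]} (hw : wronskian P Q ≠ 0) {x y : ℚ} {t : ℕ}
    (hlt : |((wronskian P Q).leadingCoeff : ℝ)| < (x.den : ℝ) ^ t) :
    ∃ k ≤ t, eval x ((hasseDeriv k (C (y.den : ℤ) * P + C y.num * Q)).map
      (Int.castRingHom ℚ)) ≠ 0 := by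
  by_contra! h
  set φ := Int.castRingHom ℚ
  set S : ℤ[X] := C (y.den : ℤ) * P + C y.num * Q with hS
  have hdvd : (X - C x) ^ (t + 1) ∣ S.map φ := by
    rw [X_sub_C_pow_dvd_iff_hasseDeriv]
    intro k hk
    rw [hasseDeriv_map]
    exact h k (by omega)
  have hdvd' : (X - C x) ^ t ∣ derivative (S.map φ) := by
    have := pow_sub_one_dvd_derivative_of_pow_dvd hdvd
    rwa [Nat.add_sub_cancel] at this
  have hSQ : (wronskian S Q).map φ = C (y.den : ℚ) * (wronskian P Q).map φ := by
    have : wronskian S Q = C (y.den : ℤ) * wronskian P Q := by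
      simp only [hS, wronskian, derivative_add, derivative_C_mul]
      ring
    rw [this]
    simp
  have hdvdW : (X - C x) ^ t ∣ (wronskian P Q).map φ := by
    have h1 : (X - C x) ^ t ∣ (wronskian S Q).map φ := by
      simp only [wronskian, Polynomial.map_sub, Polynomial.map_mul, ← derivative_map]
      exact dvd_sub (((pow_dvd_pow _ t.le_succ).trans hdvd).mul_right _) (hdvd'.mul_right _)
    rw [hSQ] at h1
    exact (IsUnit.dvd_mul_left
      (isUnit_C.2 (isUnit_iff_ne_zero.2 (by exact_mod_cast y.den_ne_zero)))).1 h1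
  have h2 := Int.le_of_dvd (abs_pos.2 (leadingCoeff_ne_zero.2 hw))
    ((dvd_abs _ _).2 (den_pow_dvd_leadingCoeff hdvdW))
  exact absurd hlt (not_lt.2 (by exact_mod_cast h2))

lemma irreducible_depressedCubic {A B : ℤ} (h : ∀ m : ℤ, m ^ 3 + B * m + A ≠ 0) :
    Irreducible (X ^ 3 + C (B : ℚ) * X + C (A : ℚ) : ℚ[X]) ∧
      (X ^ 3 + C (B : ℚ) * X + C (A : ℚ) : ℚ[X]).natDegree = 3 := by
  have hdeg : (X ^ 3 + C (B : ℚ) * X + C (A : ℚ) : ℚ[X]).natDegree = 3 := by compute_degree!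
  have hmon : (X ^ 3 + C (B : ℚ) * X + C (A : ℚ) : ℚ[X]).Monic := by monicity!
  refine ⟨?_, hdeg⟩
  rw [hmon.irreducible_iff_roots_eq_zero_of_degree_le_three (by omega) (by omega)]
  refine Multiset.eq_zero_of_forall_notMem fun r hr ↦ ?_
  have hr' : r ^ 3 + B * r + A = 0 := by simpa using (mem_roots'.1 hr).2
  have hmonZ : (X ^ 3 + C B * X + C A : ℤ[X]).Monic := by monicity!
  obtain ⟨m, hm⟩ := isInteger_of_is_root_of_monic (K := ℚ) (r := r) hmonZ (by simpa using hr')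
  refine h m ?_
  rw [← hm] at hr'
  simp only [algebraMap_int_eq, eq_intCast] at hr'
  exact_mod_cast hr'

lemma natCast_mul_two_pow_le (c t : ℕ) : ((c * t : ℕ) : ℝ) ≤ (2 ^ c) ^ t := by
  rw [← pow_mul]
  exact_mod_cast (Nat.lt_two_pow_self (n := c * t)).le

lemma exists_approximation_constant {A B : ℤ} {α : ℂ} (hα : α ^ 3 + B * α + A = 0)
    (hirr : ∀ m : ℤ, m ^ 3 + B * m + A ≠ 0) :
    ∃ L : ℝ, 1 ≤ L ∧ ∀ t : ℕ, 0 < t → ∀ x y : ℚ, L < x.den → ‖α - x‖ ≤ 1 →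
      ∃ k ≤ t, 1 ≤ (x.den : ℝ) ^ (16 * t) * y.den *
        (L ^ t * (‖α - x‖ ^ (10 * t - k) + ‖α - y‖)) := by
  obtain ⟨K, hK1, hK⟩ := exists_auxiliary hα
  obtain ⟨hf, hfdeg⟩ := irreducible_depressedCubic hirr
  set M : ℝ := 1 + ‖α‖ with hM
  have hM1 : 1 ≤ M := by have := norm_nonneg α; linarith
  set E : ℝ := 2 ^ 16 * (2 ^ 16 * K) * M ^ 16 with hE
  have hE1 : 1 ≤ E := by
    have := one_le_pow₀ hM1 (n := 16)
    rw [hE]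
    nlinarith
  set L : ℝ := 2 ^ 16 * (2 ^ 16 * (M * E)) + (2 ^ 32 * K) ^ 2 with hL
  have hLK : (2 ^ 32 * K) ^ 2 ≤ L := by
    have : 0 ≤ 2 ^ 16 * (2 ^ 16 * (M * E)) := by positivity
    linarith
  have hLM : 2 ^ 16 * (2 ^ 16 * (M * E)) ≤ L := by
    have : 0 ≤ (2 ^ 32 * K) ^ 2 := by positivity
    linarith
  have hEL : E ≤ L := by nlinarith
  refine ⟨L, hE1.trans hEL, fun t ht x y hx hαx ↦ ?_⟩
  obtain ⟨P, Q, hPQ, hPd, hQd, hPK, hQK, hvan⟩ := hK t ht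
  have hw : wronskian P Q ≠ 0 := by
    refine wronskian_ne_zero_of_hasseDeriv hf (α := α) ?_ (by omega) hPQ (h := 10 * t)
      (by rw [hfdeg]; omega) (by rw [hfdeg]; omega) hvan
    simpa using hα
  have hlt : |((wronskian P Q).leadingCoeff : ℝ)| < (x.den : ℝ) ^ t := by
    have hd := natDegree_wronskian_lt_add hw
    refine (abs_coeff_wronskian_le hPd hQd hPK hQK (by omega)).trans_lt ?_
    have h1 : (2 * (16 * t : ℕ) * K ^ t) ^ 2 ≤ ((2 ^ 32 * K) ^ 2) ^ t := by
      rw [pow_right_comm, mul_pow (2 ^ 32)]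
      have := natCast_mul_two_pow_le 32 t
      push_cast at this ⊢
      gcongr
      linarith
    refine h1.trans_lt ((pow_le_pow_left₀ (by positivity) hLK t).trans_lt ?_)
    exact pow_lt_pow_left₀ hx (by positivity) ht.ne'
  obtain ⟨k, hkt, hk⟩ := exists_hasseDeriv_eval_ne_zero hw (y := y) hlt
  refine ⟨k, hkt, ?_⟩
  set S : ℤ[X] := C (y.den : ℤ) * P + C y.num * Q with hS
  have hxM : ‖(x : ℂ)‖ ≤ M := by
    have h1 := norm_sub_norm_le (x : ℂ) α
    rw [norm_sub_rev] at h1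
    linarith
  have hx1 : (1 : ℝ) ≤ x.den := by exact_mod_cast x.pos
  -- a lower bound, since the value is a nonzero rational of known denominator
  have hlow : (1 : ℝ) ≤ (x.den : ℝ) ^ (16 * t) * ‖aeval (x : ℂ) (hasseDeriv k S)‖ := by
    have h1 := one_le_pow_mul_abs_eval_div (K := ℚ) (f := hasseDeriv k S) (a := x.num)
      (b := x.den) (by exact_mod_cast x.pos) (by
        rw [Int.cast_natCast, Rat.num_div_den]; exact hk)
    rw [Int.cast_natCast, Rat.num_div_den] at h1
    have h2 : ‖aeval (x : ℂ) (hasseDeriv k S)‖ =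
        ((|eval x ((hasseDeriv k S).map (algebraMap ℤ ℚ))| : ℚ) : ℝ) := by
      rw [eval_map_algebraMap, ← eq_ratCast (algebraMap ℚ ℂ), aeval_algebraMap_apply,
        eq_ratCast, Complex.norm_ratCast, Rat.cast_abs]
    have h3 : (1 : ℝ) ≤ (x.den : ℝ) ^ (hasseDeriv k S).natDegree *
        ‖aeval (x : ℂ) (hasseDeriv k S)‖ := by
      rw [h2]; exact_mod_cast h1
    have h4 : (hasseDeriv k S).natDegree ≤ 16 * t := by
      have h5 := natDegree_hasseDeriv_le S k
      have h6 : S.natDegree ≤ 16 * t :=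
        natDegree_add_le_of_degree_le ((natDegree_C_mul_le _ _).trans hPd.le)
          ((natDegree_C_mul_le _ _).trans hQd.le)
      omega
    refine h3.trans ?_
    gcongr
  have hEbound : ((16 * t : ℕ) : ℝ) * (2 ^ (16 * t) * K ^ t) * M ^ (16 * t) ≤ E ^ t := by
    rw [hE, mul_pow, mul_pow, mul_pow, pow_mul, pow_mul]
    have := natCast_mul_two_pow_le 16 t
    gcongr
  -- an upper bound, from the vanishing at `α`
  have hQx : ‖aeval (x : ℂ) (hasseDeriv k Q)‖ ≤ L ^ t :=
    ((norm_aeval_hasseDeriv_le hQd hQK hM1 hxM k).trans hEbound).trans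
      (pow_le_pow_left₀ (by positivity) hEL t)
  have hR : ‖aeval (x : ℂ) (hasseDeriv k P) + α * aeval (x : ℂ) (hasseDeriv k Q)‖ ≤
      L ^ t * ‖α - x‖ ^ (10 * t - k) := by
    set R : ℂ[X] := P.map (algebraMap ℤ ℂ) + α • Q.map (algebraMap ℤ ℂ) with hRdef
    have hReval : ∀ (i : ℕ) (z : ℂ), (hasseDeriv i R).eval z =
        aeval z (hasseDeriv i P) + α * aeval z (hasseDeriv i Q) := by
      intro i z
      rw [hRdef, map_add, map_smul, hasseDeriv_map, hasseDeriv_map, eval_add, eval_smul,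
        eval_map_algebraMap, eval_map_algebraMap, smul_eq_mul]
    have hRd : R.natDegree < 16 * t := by
      have h1 : R.natDegree ≤ 16 * t - 1 :=
        natDegree_add_le_of_degree_le (natDegree_map_le.trans (by omega))
          ((natDegree_smul_le _ _).trans (natDegree_map_le.trans (by omega)))
      omega
    have hαM : ‖α‖ ≤ M := by linarith
    have hRα : ∀ i, ‖(hasseDeriv i R).eval α‖ ≤ M * E ^ t := by
      intro i
      rw [hReval]
      have h1 := (norm_aeval_hasseDeriv_le hPd hPK hM1 hαM i).trans hEbound
      have h2 := (norm_aeval_hasseDeriv_le hQd hQK hM1 hαM i).trans hEbound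
      refine (norm_add_le _ _).trans ?_
      rw [norm_mul, hM, add_mul, one_mul]
      gcongr
    have h1 := norm_eval_hasseDeriv_le_of_vanishing (k := k) hRd hRα
      (fun i hi ↦ by rw [hReval]; exact hvan i hi) hαx
    rw [← hReval]
    refine h1.trans (mul_le_mul_of_nonneg_right ?_ (by positivity))
    refine le_trans ?_ (pow_le_pow_left₀ (by positivity) hLM t)
    rw [mul_pow (2 ^ 16 : ℝ), mul_pow (2 ^ 16 : ℝ), mul_pow M E, pow_mul]
    have h2 := natCast_mul_two_pow_le 16 t
    have h3 : M ≤ M ^ t := le_self_pow₀ hM1 ht.ne'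
    gcongr
  have hSx : aeval (x : ℂ) (hasseDeriv k S) = y.den * ((aeval (x : ℂ) (hasseDeriv k P) +
      α * aeval (x : ℂ) (hasseDeriv k Q)) - (α - y) * aeval (x : ℂ) (hasseDeriv k Q)) := by
    have hy : (y.den : ℂ) * y = y.num := by exact_mod_cast Rat.den_mul_eq_num y
    rw [hS, map_add, ← smul_eq_C_mul, ← smul_eq_C_mul, map_smul, map_smul, map_add, map_smul,
      map_smul]
    simp only [zsmul_eq_mul, Int.cast_natCast, ← hy]
    ring
  have hup : ‖aeval (x : ℂ) (hasseDeriv k S)‖ ≤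
      y.den * (L ^ t * (‖α - x‖ ^ (10 * t - k) + ‖α - y‖)) := by
    rw [hSx, norm_mul, Complex.norm_natCast]
    refine mul_le_mul_of_nonneg_left ((norm_sub_le _ _).trans ?_) (by positivity)
    rw [norm_mul, mul_add, mul_comm ‖α - y‖]
    gcongr
  rw [mul_assoc]
  exact hlow.trans (mul_le_mul_of_nonneg_left hup (by positivity))

end Polynomial

lemma exists_den_gt_of_infinite {S : Set ℚ} (hS : S.Infinite) {D : ℝ} (hD : ∀ x ∈ S, |(x : ℝ)| ≤ D)
    (N : ℕ) : ∃ x ∈ S, N < x.den := by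
  by_contra! h
  refine hS (((Set.finite_Icc (-⌈D * N⌉) ⌈D * N⌉).prod (Set.finite_Icc 0 N)).image
    (fun p : ℤ × ℕ ↦ (p.1 / p.2 : ℚ)) |>.subset fun x hx ↦ ?_)
  refine ⟨(x.num, x.den), ⟨?_, zero_le, h x hx⟩, Rat.num_div_den x⟩
  rw [Set.mem_Icc, ← abs_le]
  have h1 : |(x.num : ℝ)| ≤ D * N := by
    have h2 : (x.num : ℝ) = x * x.den := by exact_mod_cast (Rat.mul_den_eq_num x).symm
    have h3 : (x.den : ℝ) ≤ N := by exact_mod_cast h x hx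
    rw [h2, abs_mul, Nat.abs_cast]
    have := abs_nonneg (x : ℝ)
    exact mul_le_mul (hD x hx) h3 (by positivity) (this.trans (hD x hx))
  have := h1.trans (Int.le_ceil _)
  exact_mod_cast this

/-- Thue's theorem for cubic irrationalities, with approximation exponent three. -/
lemma finite_rat_approximations {A B : ℤ} {α : ℂ} (hα : α ^ 3 + B * α + A = 0)
    (hirr : ∀ m : ℤ, m ^ 3 + B * m + A ≠ 0) {C : ℝ} (hC : 1 ≤ C) :
    {x : ℚ | ‖α - x‖ ≤ C / (x.den : ℝ) ^ 3}.Finite := by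
  by_contra hinf
  obtain ⟨L, hL1, hL⟩ := Polynomial.exists_approximation_constant hα hirr
  have hlarge := exists_den_gt_of_infinite hinf (D := ‖α‖ + C) fun x hx ↦ by
    have h1 : ‖α - x‖ ≤ C := by
      refine (Set.mem_ofPred.1 hx).trans (div_le_self (by linarith) (one_le_pow₀ ?_))
      exact_mod_cast x.pos
    have h2 := norm_sub_norm_le (x : ℂ) α
    rw [norm_sub_rev, Complex.norm_ratCast] at h2
    linarith
  obtain ⟨x, hx, hxN⟩ := hlarge ⌈2 * L * C ^ 9⌉₊
  obtain ⟨y, hy, hyN⟩ := hlarge (x.den ^ 51)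
  rw [Set.mem_ofPred] at hx hy
  have ha : 2 * L * C ^ 9 < x.den := (Nat.le_ceil _).trans_lt (by exact_mod_cast hxN)
  have hb : (x.den : ℝ) ^ 51 < y.den := by exact_mod_cast hyN
  generalize hadef : (x.den : ℝ) = a at hx ha hb
  generalize hbdef : (y.den : ℝ) = b at hy hb
  have hC9 : C ≤ C ^ 9 := le_self_pow₀ hC (by norm_num)
  have hLC : L * C ≤ L * C ^ 9 := by gcongr
  have hLa : L < a := by nlinarith
  have hCa : C ≤ a := by nlinarith
  have ha1 : 1 < a := by linarith
  have ha0 : 0 < a := by linarith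
  have hb0 : 0 < b := (pow_pos ha0 51).trans hb
  obtain ⟨t, ht1, ht2⟩ := exists_nat_pow_near (x := b ^ 2) (y := a ^ 17)
    (one_le_pow₀ ((one_le_pow₀ ha1.le).trans hb.le)) (one_lt_pow₀ ha1 (by norm_num))
  rw [← pow_mul] at ht1 ht2
  have ht6 : 6 ≤ t := by
    have h1 : a ^ 102 < a ^ (17 * (t + 1)) := by
      refine lt_of_le_of_lt ?_ ht2
      calc a ^ 102 = (a ^ 51) ^ 2 := by rw [← pow_mul]
        _ ≤ b ^ 2 := by gcongr
    have := (pow_lt_pow_iff_right₀ ha1).1 h1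
    omega
  have hba : b ≤ a ^ (10 * t) := by
    refine le_of_sq_le_sq ?_ (by positivity)
    rw [← pow_mul]
    exact ht2.le.trans (pow_le_pow_right₀ ha1.le (by omega))
  have hε : C / a ^ 3 ≤ 1 := by
    rw [div_le_one (by positivity)]
    exact hCa.trans (le_self_pow₀ ha1.le (by norm_num))
  obtain ⟨k, hkt, hk⟩ := hL t (by omega) x y (by rw [hadef]; exact hLa) (hx.trans hε)
  rw [hadef, hbdef] at hk
  have hx' : ‖α - x‖ ^ (10 * t - k) ≤ C ^ (9 * t) / a ^ (27 * t) := by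
    calc ‖α - x‖ ^ (10 * t - k) ≤ (C / a ^ 3) ^ (10 * t - k) := by gcongr
      _ ≤ (C / a ^ 3) ^ (9 * t) := pow_le_pow_of_le_one (by positivity) hε (by omega)
      _ = C ^ (9 * t) / a ^ (27 * t) := by rw [div_pow, ← pow_mul]; congr 2; ring
  have hhalf : ∀ r : ℝ, 0 ≤ r → r ≤ L * C ^ 9 → (r / a) ^ t < 1 / 2 := by
    intro r hr hrL
    have h1 : r / a < 1 / 2 := by rw [div_lt_div_iff₀ ha0 two_pos]; linarith
    refine lt_of_le_of_lt (pow_le_of_le_one (by positivity) (by linarith) (by omega)) h1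
  have hterm₁ : a ^ (16 * t) * b * (L ^ t * ‖α - x‖ ^ (10 * t - k)) < 1 / 2 := by
    refine lt_of_le_of_lt ?_ (hhalf (L * C ^ 9) (by positivity) le_rfl)
    calc a ^ (16 * t) * b * (L ^ t * ‖α - x‖ ^ (10 * t - k))
        ≤ a ^ (16 * t) * a ^ (10 * t) * (L ^ t * (C ^ (9 * t) / a ^ (27 * t))) := by gcongr
      _ = (L * C ^ 9 / a) ^ t := by
        rw [div_pow, mul_pow, ← pow_mul]
        field_simp
        ring
  have hterm₂ : a ^ (16 * t) * b * (L ^ t * ‖α - y‖) < 1 / 2 := by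
    refine lt_of_le_of_lt ?_ (hhalf (L * C) (by positivity) hLC)
    have hCt : C ≤ C ^ t := le_self_pow₀ hC (by omega)
    calc a ^ (16 * t) * b * (L ^ t * ‖α - y‖)
        ≤ a ^ (16 * t) * b * (L ^ t * (C ^ t / b ^ 3)) := by
          have : ‖α - y‖ ≤ C ^ t / b ^ 3 := hy.trans (by gcongr)
          gcongr
      _ = a ^ (16 * t) * (L * C) ^ t / b ^ 2 := by
        rw [mul_pow]; field_simp
      _ ≤ a ^ (16 * t) * (L * C) ^ t / a ^ (17 * t) := by gcongr
      _ = (L * C / a) ^ t := by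
        rw [div_pow]
        field_simp
        ring
  have : (1 : ℝ) < 1 := by
    refine hk.trans_lt ?_
    rw [mul_add, mul_add]
    linarith
  exact lt_irrefl _ this

lemma exists_distinct_complex_roots {A B : ℤ} (hirr : ∀ m : ℤ, m ^ 3 + B * m + A ≠ 0) :
    ∃ α β γ : ℂ, α ≠ β ∧ α ≠ γ ∧ β ≠ γ ∧
      ∀ z : ℂ, z ^ 3 + B * z + A = (z - α) * (z - β) * (z - γ) := by
  obtain ⟨α, hα⟩ := IsAlgClosed.exists_root
    (Polynomial.X ^ 3 + Polynomial.C (B : ℂ) * Polynomial.X + Polynomial.C (A : ℂ)) (by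
      rw [show Polynomial.degree _ = 3 by compute_degree!]; decide)
  obtain ⟨β, hβ⟩ := IsAlgClosed.exists_root
    (Polynomial.X ^ 2 + Polynomial.C α * Polynomial.X + Polynomial.C (α ^ 2 + B)) (by
      rw [show Polynomial.degree _ = 2 by compute_degree!]; decide)
  have hα' : α ^ 3 + B * α + A = 0 := by simpa using hα
  have hβ' : β ^ 2 + α * β + (α ^ 2 + B) = 0 := by simpa using hβ
  have hfac : ∀ z : ℂ, z ^ 3 + B * z + A = (z - α) * (z - β) * (z - (-α - β)) := fun z ↦ by
    linear_combination hα' + (z - α) * hβ'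
  have hsimple : ∀ r : ℂ, r ^ 3 + B * r + A = 0 → 3 * r ^ 2 + B ≠ 0 := by
    intro r hr
    have hsep := (Polynomial.irreducible_depressedCubic hirr).1.separable
    have hne := hsep.eval₂_derivative_ne_zero (algebraMap ℚ ℂ) (x := r) (by
      simpa only [Polynomial.eval₂_add, Polynomial.eval₂_mul, Polynomial.eval₂_pow,
        Polynomial.eval₂_X, Polynomial.eval₂_C, eq_ratCast, Rat.cast_intCast] using hr)
    simp only [Polynomial.derivative_add, Polynomial.derivative_C_mul, Polynomial.derivative_X_pow,
      Polynomial.derivative_X, Polynomial.derivative_C, Polynomial.eval₂_add,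
      Polynomial.eval₂_mul, Polynomial.eval₂_pow, Polynomial.eval₂_X, Polynomial.eval₂_C,
      Polynomial.eval₂_one, Polynomial.eval₂_zero, eq_ratCast, Rat.cast_intCast] at hne
    intro h
    refine hne ?_
    push_cast
    linear_combination h
  have hβ0 : β ^ 3 + B * β + A = 0 := by rw [hfac]; ring
  refine ⟨α, β, -α - β, ?_, ?_, ?_, hfac⟩
  · rintro rfl
    exact hsimple _ hα' (by linear_combination hβ')
  · intro h
    exact hsimple _ hα' (by linear_combination hβ' + (α - β) * h)
  · intro h
    exact hsimple _ hβ0 (by linear_combination hβ' + (β - α) * h)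

lemma norm_sub_nearest_le {r s u z : ℂ} {δ : ℝ} (hδ : 0 ≤ δ) (hs : ‖z - r‖ ≤ ‖z - s‖)
    (hu : ‖z - r‖ ≤ ‖z - u‖) (hrs : δ ≤ ‖r - s‖) (hru : δ ≤ ‖r - u‖) :
    δ ^ 2 / 4 * ‖z - r‖ ≤ ‖(z - r) * (z - s) * (z - u)‖ := by
  have h1 : ∀ v, ‖z - r‖ ≤ ‖z - v‖ → δ ≤ ‖r - v‖ → δ / 2 ≤ ‖z - v‖ := by
    intro v h2 h3
    have := norm_sub_le_norm_sub_add_norm_sub r z v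
    rw [norm_sub_rev r z] at this
    linarith
  rw [norm_mul, norm_mul]
  calc δ ^ 2 / 4 * ‖z - r‖ = ‖z - r‖ * (δ / 2) * (δ / 2) := by ring
    _ ≤ _ := by
      have := h1 s hs hrs
      have := h1 u hu hru
      gcongr

lemma exists_root_near {α β γ : ℂ} (hαβ : α ≠ β) (hαγ : α ≠ γ) (hβγ : β ≠ γ) :
    ∃ c : ℝ, 0 < c ∧ ∀ z : ℂ, ∃ r : ℂ, (r = α ∨ r = β ∨ r = γ) ∧
      c * ‖z - r‖ ≤ ‖(z - α) * (z - β) * (z - γ)‖ := by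
  set δ := min ‖α - β‖ (min ‖α - γ‖ ‖β - γ‖)
  have hδ : 0 < δ :=
    lt_min (norm_sub_pos_iff.2 hαβ) (lt_min (norm_sub_pos_iff.2 hαγ) (norm_sub_pos_iff.2 hβγ))
  have h1 : δ ≤ ‖α - β‖ := min_le_left _ _
  have h2 : δ ≤ ‖α - γ‖ := (min_le_right _ _).trans (min_le_left _ _)
  have h3 : δ ≤ ‖β - γ‖ := (min_le_right _ _).trans (min_le_right _ _)
  refine ⟨δ ^ 2 / 4, by positivity, fun z ↦ ?_⟩
  by_cases hα : ‖z - α‖ ≤ ‖z - β‖ ∧ ‖z - α‖ ≤ ‖z - γ‖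
  · exact ⟨α, by simp, norm_sub_nearest_le hδ.le hα.1 hα.2 h1 h2⟩
  by_cases hβ : ‖z - β‖ ≤ ‖z - α‖ ∧ ‖z - β‖ ≤ ‖z - γ‖
  · refine ⟨β, by simp, ?_⟩
    rw [mul_comm (z - α)]
    exact norm_sub_nearest_le hδ.le hβ.1 hβ.2 (by rwa [norm_sub_rev]) h3
  have hγ : ‖z - γ‖ ≤ ‖z - α‖ ∧ ‖z - γ‖ ≤ ‖z - β‖ := by
    constructor <;> by_contra! h
    · exact hβ ⟨by by_contra! h'; exact hα ⟨h'.le, h.le⟩, by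
        by_contra! h'
        exact hα ⟨by linarith, h.le⟩⟩
    · exact hα ⟨by by_contra! h'; exact hβ ⟨h'.le, h.le⟩, by
        by_contra! h'
        exact hβ ⟨by linarith, h.le⟩⟩
  refine ⟨γ, by simp, ?_⟩
  rw [show (z - α) * (z - β) * (z - γ) = (z - γ) * (z - α) * (z - β) by ring]
  exact norm_sub_nearest_le hδ.le hγ.1 hγ.2 (by rwa [norm_sub_rev]) (by rwa [norm_sub_rev])

lemma finite_thue_of_irreducible {A B N : ℤ} (hirr : ∀ m : ℤ, m ^ 3 + B * m + A ≠ 0)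
    (hN : N ≠ 0) : {p : ℤ × ℤ | p.2 ^ 3 + B * p.2 * p.1 ^ 2 + A * p.1 ^ 3 = N}.Finite := by
  obtain ⟨α, β, γ, hαβ, hαγ, hβγ, hfac⟩ := exists_distinct_complex_roots hirr
  obtain ⟨c, hc, hnear⟩ := exists_root_near hαβ hαγ hβγ
  set K : ℝ := 1 + |(N : ℝ)| / c
  have hK : 1 ≤ K := by
    have : 0 ≤ |(N : ℝ)| / c := by positivity
    linarith
  have hroot : ∀ r : ℂ, (r = α ∨ r = β ∨ r = γ) → r ^ 3 + B * r + A = 0 := by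
    intro r hr
    rw [hfac]
    rcases hr with rfl | rfl | rfl <;> ring
  have hU := ((finite_rat_approximations (hroot α (by simp)) hirr hK).union
    (finite_rat_approximations (hroot β (by simp)) hirr hK)).union
    (finite_rat_approximations (hroot γ (by simp)) hirr hK)
  set U := ({x : ℚ | ‖α - x‖ ≤ K / (x.den : ℝ) ^ 3} ∪ {x : ℚ | ‖β - x‖ ≤ K / (x.den : ℝ) ^ 3}) ∪
    {x : ℚ | ‖γ - x‖ ≤ K / (x.den : ℝ) ^ 3}
  have hcube : Function.Injective fun n : ℤ ↦ n ^ 3 := (Odd.strictMono_pow (by decide)).injective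
  have hcubeQ : Function.Injective fun n : ℚ ↦ n ^ 3 := (Odd.strictMono_pow (by decide)).injective
  -- the solution is determined by the ratio of its coordinates
  have hratio : ∀ p : ℤ × ℤ, p.1 ≠ 0 → p.2 ^ 3 + B * p.2 * p.1 ^ 2 + A * p.1 ^ 3 = N →
      ((p.2 / p.1 : ℚ) ^ 3 + B * (p.2 / p.1 : ℚ) + A) * (p.1 : ℚ) ^ 3 = N := by
    intro p hp h
    have hp' : (p.1 : ℚ) ≠ 0 := by exact_mod_cast hp
    rw [← h]
    push_cast
    field_simp
  have hzero : {p : ℤ × ℤ | p.1 = 0 ∧ p.2 ^ 3 = N}.Finite := by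
    refine Set.Subsingleton.finite fun p hp p' hp' ↦ ?_
    exact Prod.ext (hp.1.trans hp'.1.symm) (hcube (hp.2.trans hp'.2.symm))
  have hnonzero : {p : ℤ × ℤ | p.1 ≠ 0 ∧
      p.2 ^ 3 + B * p.2 * p.1 ^ 2 + A * p.1 ^ 3 = N}.Finite := by
    refine Set.Finite.of_injOn (f := fun p : ℤ × ℤ ↦ (p.2 / p.1 : ℚ)) (t := U) ?_ ?_ hU
    · rintro p ⟨hp, h⟩
      have hx := hratio p hp h
      set x : ℚ := p.2 / p.1 with hxdef
      have hden : (x.den : ℝ) ≤ |(p.1 : ℝ)| := by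
        have h1 : (x.den : ℤ) ∣ p.1 := by
          simpa [hxdef, Rat.divInt_eq_div] using Rat.den_dvd p.2 p.1
        have h2 := Int.le_of_dvd (abs_pos.2 hp) ((dvd_abs _ _).2 h1)
        exact_mod_cast h2
      have hden0 : (0 : ℝ) < x.den := by exact_mod_cast x.pos
      obtain ⟨r, hr, hle⟩ := hnear x
      rw [← hfac] at hle
      have h3 : ‖(x : ℂ) ^ 3 + B * x + A‖ * |(p.1 : ℝ)| ^ 3 = |(N : ℝ)| := by
        have h4 : ((x : ℂ) ^ 3 + B * x + A) * (p.1 : ℂ) ^ 3 = N := by exact_mod_cast hx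
        have h5 := congrArg norm h4
        rwa [norm_mul, norm_pow, Complex.norm_intCast, Complex.norm_intCast] at h5
      have h6 : ‖r - x‖ ≤ K / (x.den : ℝ) ^ 3 := by
        rw [le_div_iff₀ (by positivity), norm_sub_rev]
        calc ‖x - r‖ * (x.den : ℝ) ^ 3 ≤ ‖x - r‖ * |(p.1 : ℝ)| ^ 3 := by gcongr
          _ = c * ‖x - r‖ * |(p.1 : ℝ)| ^ 3 / c := by field_simp
          _ ≤ ‖(x : ℂ) ^ 3 + B * x + A‖ * |(p.1 : ℝ)| ^ 3 / c := by gcongr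
          _ = |(N : ℝ)| / c := by rw [h3]
          _ ≤ K := by simp only [K]; linarith
      rcases hr with rfl | rfl | rfl
      · exact Or.inl (Or.inl h6)
      · exact Or.inl (Or.inr h6)
      · exact Or.inr h6
    · rintro p ⟨hp, h⟩ p' ⟨hp', h'⟩ heq
      have h1 := hratio p hp h
      have h2 := hratio p' hp' h'
      simp only at heq
      rw [← heq, ← h1] at h2
      have hN' : (N : ℚ) ≠ 0 := by exact_mod_cast hN
      have h3 := hcubeQ (mul_left_cancel₀ (left_ne_zero_of_mul (h1 ▸ hN')) h2)
      have h4 : p.1 = p'.1 := by exact_mod_cast h3.symm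
      rw [← h4, div_left_inj' (by exact_mod_cast hp)] at heq
      exact Prod.ext h4 (by exact_mod_cast heq)
  refine (hzero.union hnonzero).subset fun p hp ↦ ?_
  by_cases h0 : p.1 = 0
  · exact Or.inl ⟨h0, by simpa [h0] using hp⟩
  · exact Or.inr ⟨h0, hp⟩

lemma finite_thue_of_root {A B N m : ℤ} (hm : m ^ 3 + B * m + A = 0) (hAB : A ≠ 0 ∨ B ≠ 0)
    (hN : N ≠ 0) : {p : ℤ × ℤ | p.2 ^ 3 + B * p.2 * p.1 ^ 2 + A * p.1 ^ 3 = N}.Finite := by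
  let f : ℤ → Polynomial ℤ := fun d ↦ Polynomial.C (d * (3 * m ^ 2 + B)) * Polynomial.X ^ 2 +
    Polynomial.C (3 * d ^ 2 * m) * Polynomial.X + Polynomial.C (d ^ 3 - N)
  have hf : ∀ d, d ≠ 0 → f d ≠ 0 := by
    intro d hd h
    have h2 : d * (3 * m ^ 2 + B) = 0 := by
      simpa only [f, Polynomial.coeff_add, Polynomial.coeff_C_mul, Polynomial.coeff_X_pow,
        Polynomial.coeff_X, Polynomial.coeff_C, Polynomial.coeff_zero, OfNat.ofNat_ne_zero,
        OfNat.one_ne_ofNat, OfNat.ofNat_ne_one, one_ne_zero, if_true, if_false, mul_one, mul_zero,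
        add_zero, zero_add] using congrArg (Polynomial.coeff · 2) h
    have h1 : 3 * d ^ 2 * m = 0 := by
      simpa only [f, Polynomial.coeff_add, Polynomial.coeff_C_mul, Polynomial.coeff_X_pow,
        Polynomial.coeff_X, Polynomial.coeff_C, Polynomial.coeff_zero, OfNat.ofNat_ne_zero,
        OfNat.one_ne_ofNat, OfNat.ofNat_ne_one, one_ne_zero, if_true, if_false, mul_one, mul_zero,
        add_zero, zero_add] using congrArg (Polynomial.coeff · 1) h
    have hm0 : m = 0 := by simpa [hd] using h1
    have hB : B = 0 := by simpa [hd, hm0] using h2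
    have hA : A = 0 := by simpa [hm0] using hm
    exact hAB.elim (· hA) (· hB)
  have hfin : (⋃ d ∈ Set.Icc (-|N|) |N| \ {0},
      (fun q : ℤ ↦ (q, d + m * q)) '' {q | (f d).IsRoot q}).Finite := by
    refine ((Set.finite_Icc _ _).sdiff).biUnion fun d hd ↦ Set.Finite.image _ ?_
    exact Polynomial.finite_setOfPred_isRoot (hf d hd.2)
  refine hfin.subset fun p hp ↦ ?_
  have hp' : p.2 ^ 3 + B * p.2 * p.1 ^ 2 + A * p.1 ^ 3 = N := hp
  set d := p.2 - m * p.1 with hd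
  have hmul : d * (d ^ 2 + 3 * d * m * p.1 + (3 * m ^ 2 + B) * p.1 ^ 2) = N := by
    rw [← hp', hd]
    linear_combination (-p.1 ^ 3) * hm
  have hd0 : d ≠ 0 := by
    intro h
    rw [h, zero_mul] at hmul
    exact hN hmul.symm
  have hdN : |d| ≤ |N| :=
    Int.le_of_dvd (abs_pos.2 hN) (abs_dvd_abs _ _ |>.2 (Dvd.intro _ hmul))
  simp only [Set.mem_iUnion]
  refine ⟨d, ⟨abs_le.1 hdN, hd0⟩, p.1, ?_, Prod.ext rfl (by simp [hd])⟩
  simp only [f, Set.mem_ofPred, Polynomial.IsRoot, Polynomial.eval_add, Polynomial.eval_mul,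
    Polynomial.eval_C, Polynomial.eval_X, Polynomial.eval_pow]
  linear_combination hmul

lemma finite_thue {A B N : ℤ} (hAB : A ≠ 0 ∨ B ≠ 0) (hN : N ≠ 0) :
    {p : ℤ × ℤ | p.2 ^ 3 + B * p.2 * p.1 ^ 2 + A * p.1 ^ 3 = N}.Finite := by
  by_cases h : ∃ m : ℤ, m ^ 3 + B * m + A = 0
  · obtain ⟨m, hm⟩ := h
    exact finite_thue_of_root hm hAB hN
  · push Not at h
    exact finite_thue_of_irreducible h hN

lemma finite_cubic_representations {a b c : ℤ} (hc : c ≠ 0) (hab : a ≠ 0 ∨ b ≠ 0) :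
    {p : ℤ × ℤ | a * p.1 ^ 3 + b * p.1 ^ 2 * p.2 + c * p.2 ^ 3 = c}.Finite := by
  refine Set.Finite.of_injOn (f := fun p : ℤ × ℤ ↦ (p.1, c * p.2)) ?_ ?_
    (finite_thue (A := a * c ^ 2) (B := b * c) (N := c ^ 3) (by simpa [hc] using hab)
      (pow_ne_zero 3 hc))
  · intro p (hp : _ = _)
    simp only [Set.mem_ofPred]
    linear_combination c ^ 2 * hp
  · intro p _ p' _ h
    simp only [Prod.mk.injEq, mul_right_inj' hc] at h
    exact Prod.ext h.1 h.2

/-- The coefficient identities expressing that `T` carries one depressed binary cubic form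
to another with the same last coefficient. -/
lemma coeff_identities_of_matAct_eq {a b c a' b' : ℤ} {T : Matrix (Fin 2) (Fin 2) ℤ}
    (h : matAct T (C a * X 0 ^ 3 + C b * X 0 ^ 2 * X 1 + C c * X 1 ^ 3) =
      C a' * X 0 ^ 3 + C b' * X 0 ^ 2 * X 1 + C c * X 1 ^ 3) :
    a * T 0 1 ^ 3 + b * T 0 1 ^ 2 * T 1 1 + c * T 1 1 ^ 3 = c ∧
    3 * a * T 0 0 * T 0 1 ^ 2 + b * (T 0 1 ^ 2 * T 1 0 + 2 * T 0 0 * T 0 1 * T 1 1) +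
      3 * c * T 1 0 * T 1 1 ^ 2 = 0 ∧
    a' = a * T 0 0 ^ 3 + b * T 0 0 ^ 2 * T 1 0 + c * T 1 0 ^ 3 ∧
    b' = 3 * a * T 0 0 ^ 2 * T 0 1 + b * (T 0 0 ^ 2 * T 1 1 + 2 * T 0 0 * T 0 1 * T 1 0) +
      3 * c * T 1 0 ^ 2 * T 1 1 := by
  have key : ∀ x y : ℤ, a * (T 0 0 * x + T 0 1 * y) ^ 3 +
      b * (T 0 0 * x + T 0 1 * y) ^ 2 * (T 1 0 * x + T 1 1 * y) +
      c * (T 1 0 * x + T 1 1 * y) ^ 3 = a' * x ^ 3 + b' * x ^ 2 * y + c * y ^ 3 := by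
    intro x y
    simpa [matAct, Fin.sum_univ_two] using congrArg (eval ![x, y]) h
  have h01 := key 0 1
  have h10 := key 1 0
  have h11 := key 1 1
  have h11' := key (-1) 1
  refine ⟨by linear_combination h01, ?_, by linear_combination -h10, ?_⟩
  · refine mul_left_cancel₀ two_ne_zero ?_
    linear_combination h11 - h11' - 2 * h10
  · refine mul_left_cancel₀ two_ne_zero ?_
    linear_combination -h11 - h11' + 2 * h01

/-- Lemma 3.12. For a binary cubic form
`F = a·x³ + b·x²y + c·y³` with `c ≠ 0`, the set of pairs `(a', b') ∈ ℤ²` such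
that some `T ∈ SL(2, ℤ)` gives `T·F = a'·x³ + b'·x²y + c·y³` is finite. -/
theorem stmt6 (a b c : ℤ) (hc : c ≠ 0) (F : MvPolynomial (Fin 2) ℤ)
    (hF : F = C a * X 0 ^ 3 + C b * X 0 ^ 2 * X 1 + C c * X 1 ^ 3) :
    {p : ℤ × ℤ | ∃ T : Matrix (Fin 2) (Fin 2) ℤ, T.det = 1 ∧
      matAct T F = C p.1 * X 0 ^ 3 + C p.2 * X 0 ^ 2 * X 1 + C c * X 1 ^ 3}.Finite := by
  subst hF
  by_cases hab : a ≠ 0 ∨ b ≠ 0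
  · let φ : ℤ × ℤ → ℤ × ℤ := fun v ↦
      let p := (b * v.1 ^ 2 + 3 * c * v.2 ^ 2) / (3 * c)
      let r := -(3 * a * v.1 ^ 2 + 2 * b * v.1 * v.2) / (3 * c)
      (a * p ^ 3 + b * p ^ 2 * r + c * r ^ 3,
        3 * a * p ^ 2 * v.1 + b * (p ^ 2 * v.2 + 2 * p * v.1 * r) + 3 * c * r ^ 2 * v.2)
    refine ((finite_cubic_representations hc hab).image φ).subset ?_
    rintro ⟨a', b'⟩ ⟨T, hdet, hT⟩
    obtain ⟨h₁, h₂, h₃, h₄⟩ := coeff_identities_of_matAct_eq hT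
    rw [Matrix.det_fin_two] at hdet
    have h3c : 3 * c ≠ 0 := mul_ne_zero three_ne_zero hc
    have hp : (b * T 0 1 ^ 2 + 3 * c * T 1 1 ^ 2) / (3 * c) = T 0 0 :=
      Int.ediv_eq_of_eq_mul_right h3c (by
        linear_combination (-(b * T 0 1 ^ 2 + 3 * c * T 1 1 ^ 2)) * hdet + 3 * T 0 0 * h₁ -
          T 0 1 * h₂)
    have hr : -(3 * a * T 0 1 ^ 2 + 2 * b * T 0 1 * T 1 1) / (3 * c) = T 1 0 :=
      Int.ediv_eq_of_eq_mul_right h3c (by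
        linear_combination (3 * a * T 0 1 ^ 2 + 2 * b * T 0 1 * T 1 1) * hdet + 3 * T 1 0 * h₁ -
          T 1 1 * h₂)
    refine ⟨(T 0 1, T 1 1), h₁, ?_⟩
    simp only [φ, hp, hr]
    exact Prod.ext h₃.symm h₄.symm
  · push Not at hab
    obtain ⟨rfl, rfl⟩ := hab
    refine (Set.finite_singleton ((0 : ℤ), (0 : ℤ))).subset ?_
    rintro ⟨a', b'⟩ ⟨T, -, hT⟩
    obtain ⟨h₁, h₂, h₃, h₄⟩ := coeff_identities_of_matAct_eq hT
    have hs : T 1 1 ≠ 0 := by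
      intro h
      simp only [h] at h₁
      exact hc (by linear_combination -h₁)
    have hr : T 1 0 = 0 := by simpa [hc, hs] using h₂
    simp_all
end
end

section
/- Let F(x,y) = a·x³ + b·x²y + c·y³ ∈ ℤ[x,y] be a binary cubic form with integer coefficients such that c ≠ 0. Then the set of triples (a',b',c') ∈ ℤ³ with c' ≠ 0 for which there exists T ∈ SL(2,ℤ) with (T·F)(x,y) = a'·x³ + b'·x²y + c'·y³ is finite. -/
open MvPolynomial

noncomputable section

/-- The integer `3 ^ l * ∏ i < l, (3 * i + a) / l !`, a normalized binomial coefficient with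
upper argument in `ℤ / 3`. -/
def thirdChoose (a l : ℕ) : ℕ := 3 ^ l * (∏ i ∈ Finset.range l, (3 * i + a)) / l.factorial

lemma factorial_dvd_three_pow_mul_prod (a l : ℕ) :
    l.factorial ∣ 3 ^ l * ∏ i ∈ Finset.range l, (3 * i + a) := by
  obtain ⟨e, m, hm, hfac⟩ :=
    Nat.exists_eq_pow_mul_and_not_dvd l.factorial_ne_zero 3 (by norm_num)
  have hcop : Nat.Coprime 3 m := (Nat.Prime.coprime_iff_not_dvd Nat.prime_three).2 hm
  have : Fact (Nat.Prime 3) := ⟨Nat.prime_three⟩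
  have he : e ≤ l := by
    refine le_trans ?_ (padicValNat_factorial_le 3 l)
    exact (padicValNat_dvd_iff_le l.factorial_ne_zero).1 ⟨m, hfac⟩
  rw [hfac]
  refine mul_dvd_mul (pow_dvd_pow 3 he) ?_
  have hm' : IsCoprime (3 : ℤ) m := by exact_mod_cast Nat.isCoprime_iff_coprime.2 hcop
  obtain ⟨u, w, huw⟩ := hm'
  have h1 : (m : ℤ) ∣ 3 ^ l * ∏ i ∈ Finset.range l, (u * a + i) := by
    refine Dvd.dvd.mul_left ?_ _
    refine dvd_trans ?_ (Nat.factorial_coe_dvd_prod l (u * a))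
    rw [hfac]; push_cast; exact dvd_mul_left _ _
  have h2 : (3 : ℤ) ^ l * ∏ i ∈ Finset.range l, (u * a + i) ≡
      ∏ i ∈ Finset.range l, (3 * i + a : ℤ) [ZMOD m] := by
    have : (3 : ℤ) ^ l * ∏ i ∈ Finset.range l, (u * a + i) =
        ∏ i ∈ Finset.range l, (3 * (u * a + i)) := by
      rw [Finset.prod_mul_distrib]; simp
    rw [this]
    apply Int.ModEq.prod
    intro i _
    rw [Int.modEq_iff_dvd]
    exact ⟨w * a, by linear_combination (-a : ℤ) * huw⟩
  have : (m : ℤ) ∣ ((∏ i ∈ Finset.range l, (3 * i + a) : ℕ) : ℤ) := by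
    push_cast; exact (h2.dvd_iff).1 h1
  exact_mod_cast this

lemma thirdChoose_mul_factorial (a l : ℕ) :
    thirdChoose a l * l.factorial = 3 ^ l * ∏ i ∈ Finset.range l, (3 * i + a) :=
  Nat.div_mul_cancel (factorial_dvd_three_pow_mul_prod a l)

lemma thirdChoose_le {a k : ℕ} (l : ℕ) (ha : a ≤ 3 * k + 4) :
    thirdChoose a l ≤ 9 ^ l * 2 ^ (k + l + 1) := by
  refine Nat.le_of_mul_le_mul_right ?_ l.factorial_pos
  rw [thirdChoose_mul_factorial]
  calc 3 ^ l * ∏ i ∈ Finset.range l, (3 * i + a)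
      ≤ 3 ^ l * ∏ i ∈ Finset.range l, (3 * (k + 1 + 1 + i)) := by
        gcongr with i _; omega
    _ = 9 ^ l * (k + 1 + 1).ascFactorial l := by
        rw [Finset.prod_mul_distrib, Nat.ascFactorial_eq_prod_range, ← mul_assoc]
        simp [← mul_pow]
    _ = 9 ^ l * (k + l + 1).choose l * l.factorial := by
        rw [Nat.ascFactorial_eq_factorial_mul_choose]
        rw [show k + 1 + l = k + l + 1 by ring]; ring
    _ ≤ 9 ^ l * 2 ^ (k + l + 1) * l.factorial := by
        gcongr; exact Nat.choose_le_two_pow _ _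

/-- The coefficients of the diagonal Padé approximants of the cube root at `1`, scaled to be
integers. -/
def padeCoeff (k l : ℕ) : ℕ := thirdChoose (3 * k + 2) l * thirdChoose (3 * l + 4) k

lemma padeCoeff_le (k l : ℕ) : padeCoeff k l ≤ 36 ^ (k + l + 1) := by
  have h1 := thirdChoose_le (a := 3 * k + 2) (k := k) l (by omega)
  have h2 := thirdChoose_le (a := 3 * l + 4) (k := l) k le_rfl
  calc padeCoeff k l ≤ (9 ^ l * 2 ^ (k + l + 1)) * (9 ^ k * 2 ^ (l + k + 1)) := Nat.mul_le_mul h1 h2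
    _ = 9 ^ (k + l) * 4 ^ (k + l + 1) := by
        rw [show (4 : ℕ) = 2 * 2 by norm_num, mul_pow]; ring
    _ ≤ 9 ^ (k + l + 1) * 4 ^ (k + l + 1) := by
        exact Nat.mul_le_mul_right _ (Nat.pow_le_pow_right (by norm_num) (by omega))
    _ = 36 ^ (k + l + 1) := by rw [← mul_pow]; norm_num

lemma padeCoeff_mul_factorial (k l : ℕ) :
    padeCoeff k l * (k.factorial * l.factorial) = 3 ^ (k + l) *
      ((∏ i ∈ Finset.range l, (3 * i + (3 * k + 2))) *
        ∏ i ∈ Finset.range k, (3 * i + (3 * l + 4))) := by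
  have h1 := thirdChoose_mul_factorial (3 * k + 2) l
  have h2 := thirdChoose_mul_factorial (3 * l + 4) k
  calc _ = (thirdChoose (3 * k + 2) l * l.factorial) *
        (thirdChoose (3 * l + 4) k * k.factorial) := by unfold padeCoeff; ring
    _ = _ := by rw [h1, h2]; ring

lemma prod_range_add_erase {M : Type*} [CommMonoid M] (k l : ℕ) (f : ℕ → M) :
    ∏ j ∈ (Finset.range (k + l + 1)).erase k, f j =
      (∏ i ∈ Finset.range k, f (k - 1 - i)) * ∏ i ∈ Finset.range l, f (k + 1 + i) := by
  have : (Finset.range (k + l + 1)).erase k =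
      Finset.range k ∪ Finset.Ico (k + 1) (k + l + 1) := by
    ext j; simp only [Finset.mem_erase, Finset.mem_range, Finset.mem_union, Finset.mem_Ico]; omega
  rw [this, Finset.prod_union, Finset.prod_range_reflect, Finset.prod_Ico_eq_prod_range]
  · congr 2; congr 1; omega
  · rw [Finset.disjoint_left]; intro j; simp; omega

lemma prod_range_add_succ {M : Type*} [CommMonoid M] (k l : ℕ) (f : ℕ → M) :
    ∏ j ∈ Finset.range (k + l + 1), f j =
      (∏ i ∈ Finset.range (k + 1), f (k - i)) * ∏ i ∈ Finset.range l, f (k + 1 + i) := by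
  rw [show k + l + 1 = k + 1 + l by ring, Finset.prod_range_add,
    ← Finset.prod_range_reflect f (k + 1)]
  simp

lemma prod_three_mul_sub_erase (k l : ℕ) :
    ∏ j ∈ (Finset.range (k + l + 1)).erase k, (3 * k - 3 * j : ℚ) =
      3 ^ (k + l) * (-1) ^ l * (k.factorial * l.factorial) := by
  rw [prod_range_add_erase]
  have h1 : ∏ i ∈ Finset.range k, (3 * k - 3 * (k - 1 - i : ℕ) : ℚ) = 3 ^ k * k.factorial := by
    rw [← Finset.prod_range_add_one_eq_factorial]
    push_cast
    rw [show (3 : ℚ) ^ k = ∏ i ∈ Finset.range k, 3 by simp, ← Finset.prod_mul_distrib]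
    refine Finset.prod_congr rfl fun i hi => ?_
    have : i + 1 ≤ k := by simpa using hi
    rw [show k - 1 - i = k - (i + 1) by omega, Nat.cast_sub this]
    push_cast; ring
  have h2 : ∏ i ∈ Finset.range l, (3 * k - 3 * (k + 1 + i : ℕ) : ℚ) =
      3 ^ l * (-1) ^ l * l.factorial := by
    rw [← Finset.prod_range_add_one_eq_factorial, ← mul_pow]
    push_cast
    rw [show (3 * -1 : ℚ) ^ l = ∏ i ∈ Finset.range l, (3 * -1) by simp, ← Finset.prod_mul_distrib]
    refine Finset.prod_congr rfl fun i hi => ?_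
    ring
  rw [h1, h2]; ring

lemma prod_node_even (k l : ℕ) :
    ∏ j ∈ Finset.range (k + l + 1), (3 * k - (3 * j + 1) : ℚ) =
      (-1) ^ (l + 1) * ((∏ i ∈ Finset.range k, (3 * i + 2 : ℚ)) *
        ∏ i ∈ Finset.range l, (3 * i + 4 : ℚ)) := by
  rw [prod_range_add_succ]
  have h1 : ∏ i ∈ Finset.range (k + 1), (3 * k - (3 * (k - i : ℕ) + 1) : ℚ) =
      -∏ i ∈ Finset.range k, (3 * i + 2 : ℚ) := by
    rw [Finset.prod_range_succ']
    have : ∏ i ∈ Finset.range k, (3 * k - (3 * (k - (i + 1) : ℕ) + 1) : ℚ) =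
        ∏ i ∈ Finset.range k, (3 * i + 2 : ℚ) := by
      refine Finset.prod_congr rfl fun i hi => ?_
      have : i + 1 ≤ k := by simpa using hi
      rw [Nat.cast_sub this]; push_cast; ring
    rw [this]; simp
  have h2 : ∏ i ∈ Finset.range l, (3 * k - (3 * (k + 1 + i : ℕ) + 1) : ℚ) =
      (-1) ^ l * ∏ i ∈ Finset.range l, (3 * i + 4 : ℚ) := by
    rw [show (-1 : ℚ) ^ l = ∏ i ∈ Finset.range l, (-1) by simp, ← Finset.prod_mul_distrib]
    refine Finset.prod_congr rfl fun i _ => ?_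
    push_cast; ring
  rw [h1, h2]; ring

lemma prod_node_odd (k l : ℕ) :
    ∏ j ∈ Finset.range (k + l + 1), (3 * k + 1 - 3 * j : ℚ) =
      (-1) ^ l * ((∏ i ∈ Finset.range k, (3 * i + 4 : ℚ)) *
        ∏ i ∈ Finset.range l, (3 * i + 2 : ℚ)) := by
  rw [prod_range_add_succ]
  have h1 : ∏ i ∈ Finset.range (k + 1), (3 * k + 1 - 3 * (k - i : ℕ) : ℚ) =
      ∏ i ∈ Finset.range k, (3 * i + 4 : ℚ) := by
    rw [Finset.prod_range_succ']
    have : ∏ i ∈ Finset.range k, (3 * k + 1 - 3 * (k - (i + 1) : ℕ) : ℚ) =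
        ∏ i ∈ Finset.range k, (3 * i + 4 : ℚ) := by
      refine Finset.prod_congr rfl fun i hi => ?_
      have : i + 1 ≤ k := by simpa using hi
      rw [Nat.cast_sub this]; push_cast; ring
    rw [this]; simp
  have h2 : ∏ i ∈ Finset.range l, (3 * k + 1 - 3 * (k + 1 + i : ℕ) : ℚ) =
      (-1) ^ l * ∏ i ∈ Finset.range l, (3 * i + 2 : ℚ) := by
    rw [show (-1 : ℚ) ^ l = ∏ i ∈ Finset.range l, (-1) by simp, ← Finset.prod_mul_distrib]
    refine Finset.prod_congr rfl fun i _ => ?_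
    push_cast; ring
  rw [h1, h2]; ring

/-- The common value, up to sign, of `padeCoeff` times the inverse Lagrange weight of its node. -/
def padeScale (n : ℕ) : ℚ :=
  9 ^ n * ((∏ i ∈ Finset.range n, (3 * i + 2 : ℚ)) * ∏ i ∈ Finset.range n, (3 * i + 4 : ℚ))

lemma padeScale_ne_zero (n : ℕ) : padeScale n ≠ 0 := by
  unfold padeScale; positivity

lemma padeCoeff_mul_even (k l : ℕ) :
    (padeCoeff k l : ℚ) * ((∏ j ∈ (Finset.range (k + l + 1)).erase k, (3 * k - 3 * j : ℚ)) *
      ∏ j ∈ Finset.range (k + l + 1), (3 * k - (3 * j + 1) : ℚ)) = -padeScale (k + l) := by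
  have h := congrArg (Nat.cast : ℕ → ℚ) (padeCoeff_mul_factorial k l)
  push_cast at h
  have e1 : ∏ i ∈ Finset.range (k + l), (3 * i + 2 : ℚ) = (∏ i ∈ Finset.range k, (3 * i + 2 : ℚ)) *
      ∏ i ∈ Finset.range l, (3 * i + (3 * k + 2) : ℚ) := by
    rw [Finset.prod_range_add]; congr 1
    exact Finset.prod_congr rfl fun i _ => by push_cast; ring
  have e2 : ∏ i ∈ Finset.range (k + l), (3 * i + 4 : ℚ) = (∏ i ∈ Finset.range l, (3 * i + 4 : ℚ)) *
      ∏ i ∈ Finset.range k, (3 * i + (3 * l + 4) : ℚ) := by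
    rw [add_comm k l, Finset.prod_range_add]; congr 1
    exact Finset.prod_congr rfl fun i _ => by push_cast; ring
  have hs : ((-1 : ℚ) ^ l) * (-1) ^ l = 1 := by rw [← mul_pow]; simp
  rw [prod_three_mul_sub_erase, prod_node_even, padeScale, e1, e2,
    show (9 : ℚ) ^ (k + l) = 3 ^ (k + l) * 3 ^ (k + l) by rw [← mul_pow]; norm_num]
  set P := ∏ i ∈ Finset.range k, (3 * i + 2 : ℚ)
  set Q := ∏ i ∈ Finset.range l, (3 * i + 4 : ℚ)
  rw [pow_succ]
  linear_combination (-(3 ^ (k + l) * P * Q) * ((-1 : ℚ) ^ l * (-1) ^ l)) * h -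
    3 ^ (k + l) * P * Q * (3 ^ (k + l) *
      ((∏ i ∈ Finset.range l, (3 * i + (3 * k + 2) : ℚ)) *
        ∏ i ∈ Finset.range k, (3 * i + (3 * l + 4) : ℚ))) * hs

lemma padeCoeff_mul_odd (k l : ℕ) :
    (padeCoeff l k : ℚ) * ((∏ j ∈ Finset.range (k + l + 1), (3 * k + 1 - 3 * j : ℚ)) *
      ∏ j ∈ (Finset.range (k + l + 1)).erase k, (3 * k + 1 - (3 * j + 1) : ℚ)) =
      padeScale (k + l) := by
  have h := congrArg (Nat.cast : ℕ → ℚ) (padeCoeff_mul_factorial l k)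
  push_cast at h
  have e1 : ∏ i ∈ Finset.range (k + l), (3 * i + 2 : ℚ) = (∏ i ∈ Finset.range l, (3 * i + 2 : ℚ)) *
      ∏ i ∈ Finset.range k, (3 * i + (3 * l + 2) : ℚ) := by
    rw [add_comm k l, Finset.prod_range_add]; congr 1
    exact Finset.prod_congr rfl fun i _ => by push_cast; ring
  have e2 : ∏ i ∈ Finset.range (k + l), (3 * i + 4 : ℚ) = (∏ i ∈ Finset.range k, (3 * i + 4 : ℚ)) *
      ∏ i ∈ Finset.range l, (3 * i + (3 * k + 4) : ℚ) := by
    rw [Finset.prod_range_add]; congr 1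
    exact Finset.prod_congr rfl fun i _ => by push_cast; ring
  have hs : ((-1 : ℚ) ^ l) * (-1) ^ l = 1 := by rw [← mul_pow]; simp
  simp only [add_sub_add_right_eq_sub]
  rw [prod_three_mul_sub_erase, prod_node_odd, padeScale, e1, e2,
    show (9 : ℚ) ^ (k + l) = 3 ^ (k + l) * 3 ^ (k + l) by rw [← mul_pow]; norm_num]
  set P := ∏ i ∈ Finset.range l, (3 * i + 2 : ℚ)
  set Q := ∏ i ∈ Finset.range k, (3 * i + 4 : ℚ)
  rw [add_comm l k] at h
  linear_combination ((3 ^ (k + l) * P * Q) * ((-1 : ℚ) ^ l * (-1) ^ l)) * h +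
    3 ^ (k + l) * P * Q * (3 ^ (k + l) *
      ((∏ i ∈ Finset.range k, (3 * i + (3 * l + 2) : ℚ)) *
        ∏ i ∈ Finset.range l, (3 * i + (3 * k + 4) : ℚ))) * hs

/-- Both sides differ by a multiple of a divided difference of order `2 * n + 1`. -/
lemma sum_padeCoeff_mul_eval (n : ℕ) (P : Polynomial ℚ) (hP : P.degree < (2 * n + 1 : ℕ)) :
    ∑ k ∈ Finset.range (n + 1), (padeCoeff (n - k) k : ℚ) * P.eval (3 * k + 1 : ℚ) =
      ∑ k ∈ Finset.range (n + 1), (padeCoeff k (n - k) : ℚ) * P.eval (3 * k : ℚ) := by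
  set v : ℕ ⊕ ℕ → ℚ := Sum.elim (fun k => 3 * k) (fun k => 3 * k + 1) with hv
  set s : Finset (ℕ ⊕ ℕ) := (Finset.range (n + 1)).disjSum (Finset.range (n + 1)) with hs
  have hcard : s.card = 2 * n + 1 + 1 := by simp [hs]; ring
  have hinj : Set.InjOn v s := by
    apply Function.Injective.injOn
    rintro (i | i) (j | j) hij <;> simp only [hv, Sum.elim_inl, Sum.elim_inr] at hij <;>
      norm_cast at hij
    · congr; omega
    · omega
    · omega
    · congr; omega
  have key := Lagrange.coeff_eq_sum hinj (P := P)
    (hP.trans (by rw [hcard]; exact_mod_cast Nat.lt_succ_self _))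
  rw [hcard, Nat.add_sub_cancel, Polynomial.coeff_eq_zero_of_degree_lt hP, hs,
    Finset.sum_disjSum, ← hs] at key
  have hl : ∀ k ∈ Finset.range (n + 1), P.eval (v (.inl k)) / ∏ j ∈ s.erase (.inl k),
      (v (.inl k) - v j) = -((padeCoeff k (n - k) : ℚ) * P.eval (3 * k : ℚ)) / padeScale n := by
    intro k hk
    have he : s.erase (.inl k) =
        ((Finset.range (n + 1)).erase k).disjSum (Finset.range (n + 1)) := by
      ext (i | i) <;> simp [hs]
    obtain ⟨l, rfl⟩ := Nat.exists_eq_add_of_le (Nat.lt_succ_iff.1 (Finset.mem_range.1 hk))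
    rw [he, Finset.prod_disjSum, Nat.add_sub_cancel_left]
    have h := padeCoeff_mul_even k l
    have h0 := padeScale_ne_zero (k + l)
    simp only [hv, Sum.elim_inl, Sum.elim_inr]
    have h1 := right_ne_zero_of_mul (h.trans_ne (neg_ne_zero.2 h0))
    rw [div_eq_div_iff h1 h0]
    linear_combination P.eval (3 * k : ℚ) * h
  have hr : ∀ k ∈ Finset.range (n + 1), P.eval (v (.inr k)) / ∏ j ∈ s.erase (.inr k),
      (v (.inr k) - v j) = ((padeCoeff (n - k) k : ℚ) * P.eval (3 * k + 1 : ℚ)) / padeScale n := by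
    intro k hk
    have he : s.erase (.inr k) =
        (Finset.range (n + 1)).disjSum ((Finset.range (n + 1)).erase k) := by
      ext (i | i) <;> simp [hs]
    obtain ⟨l, rfl⟩ := Nat.exists_eq_add_of_le (Nat.lt_succ_iff.1 (Finset.mem_range.1 hk))
    rw [he, Finset.prod_disjSum, Nat.add_sub_cancel_left]
    have h := padeCoeff_mul_odd k l
    have h0 := padeScale_ne_zero (k + l)
    simp only [hv, Sum.elim_inl, Sum.elim_inr]
    have h1 := right_ne_zero_of_mul (h.trans_ne h0)
    rw [div_eq_div_iff h1 h0]
    linear_combination (-P.eval (3 * k + 1 : ℚ)) * h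
  rw [Finset.sum_congr rfl hl, Finset.sum_congr rfl hr, ← Finset.sum_div, ← Finset.sum_div,
    ← add_div, eq_comm, div_eq_zero_iff, or_iff_left (padeScale_ne_zero n),
    Finset.sum_neg_distrib] at key
  linarith

lemma sum_padeCoeff_mul_choose {n j : ℕ} (hj : j ≤ 2 * n) :
    ∑ k ∈ Finset.range (n + 1), padeCoeff (n - k) k * (3 * k + 1).choose j =
      ∑ k ∈ Finset.range (n + 1), padeCoeff k (n - k) * (3 * k).choose j := by
  have h := sum_padeCoeff_mul_eval n (descPochhammer ℚ j) (by
    rw [Polynomial.degree_eq_natDegree (monic_descPochhammer ℚ j).ne_zero,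
      descPochhammer_natDegree]
    exact_mod_cast Nat.lt_succ_of_le hj)
  have e1 (k : ℕ) : (descPochhammer ℚ j).eval (3 * k + 1 : ℚ) =
      j.factorial * ((3 * k + 1).choose j : ℕ) := by
    rw [← Nat.cast_mul, ← Nat.descFactorial_eq_factorial_mul_choose,
      ← descPochhammer_eval_eq_descFactorial]; push_cast; rfl
  have e2 (k : ℕ) : (descPochhammer ℚ j).eval (3 * k : ℚ) =
      j.factorial * ((3 * k).choose j : ℕ) := by
    rw [← Nat.cast_mul, ← Nat.descFactorial_eq_factorial_mul_choose,
      ← descPochhammer_eval_eq_descFactorial]; push_cast; rfl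
  simp only [e1, e2, mul_left_comm _ (j.factorial : ℚ)] at h
  rw [← Finset.mul_sum, ← Finset.mul_sum] at h
  have hcast := mul_left_cancel₀ (by positivity) h
  exact_mod_cast hcast

/-- The denominator of the diagonal Padé approximant of the cube root at `1`. -/
def padeDen (n : ℕ) : Polynomial ℂ :=
  ∑ k ∈ Finset.range (n + 1), Polynomial.C (padeCoeff (n - k) k : ℂ) * Polynomial.X ^ k

/-- The numerator of the diagonal Padé approximant of the cube root at `1`. -/
def padeNum (n : ℕ) : Polynomial ℂ :=
  ∑ k ∈ Finset.range (n + 1), Polynomial.C (padeCoeff k (n - k) : ℂ) * Polynomial.X ^ k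

lemma eval_padeDen (n : ℕ) (t : ℂ) :
    (padeDen n).eval t = ∑ k ∈ Finset.range (n + 1), (padeCoeff (n - k) k : ℂ) * t ^ k := by
  simp [padeDen, Polynomial.eval_finsetSum]

lemma eval_padeNum (n : ℕ) (t : ℂ) :
    (padeNum n).eval t = ∑ k ∈ Finset.range (n + 1), (padeCoeff k (n - k) : ℂ) * t ^ k := by
  simp [padeNum, Polynomial.eval_finsetSum]

/-- The remainder `x * A (x ^ 3) - B (x ^ 3)` of the Padé approximation. -/
def padeRem (n : ℕ) : Polynomial ℂ :=
  Polynomial.X * (padeDen n).comp (Polynomial.X ^ 3) - (padeNum n).comp (Polynomial.X ^ 3)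

lemma eval_padeRem (n : ℕ) (x : ℂ) :
    (padeRem n).eval x = x * (padeDen n).eval (x ^ 3) - (padeNum n).eval (x ^ 3) := by
  simp [padeRem]

lemma coeff_padeRem_comp (n j : ℕ) :
    ((padeRem n).comp (Polynomial.X + 1)).coeff j =
      (∑ k ∈ Finset.range (n + 1), padeCoeff (n - k) k * (3 * k + 1).choose j : ℕ) -
        (∑ k ∈ Finset.range (n + 1), padeCoeff k (n - k) * (3 * k).choose j : ℕ) := by
  have h1 : (padeRem n).comp (Polynomial.X + 1) =
      ∑ k ∈ Finset.range (n + 1), Polynomial.C (padeCoeff (n - k) k : ℂ) *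
          (Polynomial.X + 1) ^ (3 * k + 1) -
        ∑ k ∈ Finset.range (n + 1), Polynomial.C (padeCoeff k (n - k) : ℂ) *
          (Polynomial.X + 1) ^ (3 * k) := by
    simp only [padeRem, padeDen, padeNum, Polynomial.sub_comp, Polynomial.mul_comp,
      Polynomial.sum_comp, Polynomial.X_comp, Polynomial.C_comp, Polynomial.pow_comp,
      Finset.mul_sum]
    refine congrArg₂ (· - ·) (Finset.sum_congr rfl fun k _ => ?_)
      (Finset.sum_congr rfl fun k _ => ?_)
    · rw [← pow_mul, mul_left_comm, ← pow_succ']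
    · rw [← pow_mul]
  rw [h1, Polynomial.coeff_sub, Polynomial.finsetSum_coeff, Polynomial.finsetSum_coeff]
  simp only [Polynomial.coeff_C_mul, Polynomial.coeff_X_add_one_pow]
  push_cast
  rfl

lemma coeff_padeRem_comp_eq_zero {n j : ℕ} (hj : j ≤ 2 * n) :
    ((padeRem n).comp (Polynomial.X + 1)).coeff j = 0 := by
  rw [coeff_padeRem_comp, sum_padeCoeff_mul_choose hj, sub_self]

lemma X_sub_one_pow_dvd_padeRem (n : ℕ) :
    (Polynomial.X - Polynomial.C 1) ^ (2 * n + 1) ∣ padeRem n := by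
  rw [Polynomial.X_sub_C_pow_dvd_iff, Polynomial.X_pow_dvd_iff]
  intro j hj
  rw [Polynomial.C_1]
  exact coeff_padeRem_comp_eq_zero (by omega)

lemma sum_padeCoeff_choose_le (n j e : ℕ) (f : ℕ → ℕ) (hf : ∀ k ≤ n, f k ≤ 36 ^ (n + 1))
    (he : e ≤ 1) :
    ∑ k ∈ Finset.range (n + 1), f k * (3 * k + e).choose j ≤ 576 ^ (n + 1) := by
  calc _ ≤ ∑ k ∈ Finset.range (n + 1), 36 ^ (n + 1) * 2 ^ (3 * n + 1) := by
        refine Finset.sum_le_sum fun k hk => ?_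
        have hk : k ≤ n := by simpa [Nat.lt_succ_iff] using hk
        refine Nat.mul_le_mul (hf k hk) ((Nat.choose_le_two_pow _ _).trans ?_)
        exact Nat.pow_le_pow_right (by norm_num) (by omega)
    _ = (n + 1) * (36 ^ (n + 1) * 2 ^ (3 * n + 1)) := by simp
    _ ≤ 2 ^ (n + 1) * (36 ^ (n + 1) * 2 ^ (3 * (n + 1))) := by
        gcongr
        · exact (Nat.lt_two_pow_self).le
        · norm_num
        · omega
    _ = 576 ^ (n + 1) := by rw [pow_mul, ← mul_pow, ← mul_pow]; norm_num

lemma norm_coeff_padeRem_comp_le (n j : ℕ) :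
    ‖((padeRem n).comp (Polynomial.X + 1)).coeff j‖ ≤ 576 ^ (n + 1) := by
  have h1 := sum_padeCoeff_choose_le n j 1 (fun k => padeCoeff (n - k) k)
    (fun k hk => (padeCoeff_le _ _).trans_eq (by rw [Nat.sub_add_cancel hk])) le_rfl
  have h2 := sum_padeCoeff_choose_le n j 0 (fun k => padeCoeff k (n - k))
    (fun k hk => (padeCoeff_le _ _).trans_eq (by rw [Nat.add_sub_cancel' hk])) (by norm_num)
  rw [coeff_padeRem_comp]
  simp only [add_zero] at h1 h2
  set a := ∑ k ∈ Finset.range (n + 1), padeCoeff (n - k) k * (3 * k + 1).choose j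
  set b := ∑ k ∈ Finset.range (n + 1), padeCoeff k (n - k) * (3 * k).choose j
  have : ((a : ℂ) - b) = (((a : ℝ) - b : ℝ) : ℂ) := by push_cast; rfl
  rw [this, Complex.norm_real, Real.norm_eq_abs, abs_sub_le_iff]
  have h1' : (a : ℝ) ≤ 576 ^ (n + 1) := by exact_mod_cast h1
  have h2' : (b : ℝ) ≤ 576 ^ (n + 1) := by exact_mod_cast h2
  constructor <;> linarith [Nat.cast_nonneg (α := ℝ) a, Nat.cast_nonneg (α := ℝ) b]

lemma natDegree_padeDen_le (n : ℕ) : (padeDen n).natDegree ≤ n := by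
  refine Polynomial.natDegree_sum_le_of_forall_le _ _ fun k hk => ?_
  refine (Polynomial.natDegree_C_mul_X_pow_le _ _).trans ?_
  simpa [Nat.lt_succ_iff] using hk

lemma natDegree_padeNum_le (n : ℕ) : (padeNum n).natDegree ≤ n := by
  refine Polynomial.natDegree_sum_le_of_forall_le _ _ fun k hk => ?_
  refine (Polynomial.natDegree_C_mul_X_pow_le _ _).trans ?_
  simpa [Nat.lt_succ_iff] using hk

lemma coeff_padeRem_comp_eq_zero_of_lt {n j : ℕ} (hj : 3 * n + 1 < j) :
    ((padeRem n).comp (Polynomial.X + 1)).coeff j = 0 := by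
  rw [coeff_padeRem_comp, Finset.sum_eq_zero, Finset.sum_eq_zero, sub_self]
  all_goals
    intro k hk
    have hk : k ≤ n := by simpa [Nat.lt_succ_iff] using hk
    rw [Nat.choose_eq_zero_of_lt (by omega), mul_zero]

lemma norm_eval_padeRem_le (n : ℕ) {x : ℂ} (hx : ‖x - 1‖ ≤ 1) :
    ‖(padeRem n).eval x‖ ≤ 2304 ^ (n + 1) * ‖x - 1‖ ^ (2 * n + 1) := by
  have hpow : 3 * n + 2 ≤ 4 ^ (n + 1) := by
    clear hx
    induction n with
    | zero => norm_num
    | succ n ih => rw [pow_succ]; omega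
  set Q := (padeRem n).comp (Polynomial.X + 1) with hQ
  have h1 : (padeRem n).eval x = Q.eval (x - 1) := by simp [hQ]
  have hdeg : Q.natDegree < 3 * n + 2 := by
    rw [Nat.lt_succ_iff, Polynomial.natDegree_le_iff_coeff_eq_zero]
    exact fun j hj => coeff_padeRem_comp_eq_zero_of_lt hj
  rw [h1, Polynomial.eval_eq_sum_range' hdeg]
  calc _ ≤ ∑ j ∈ Finset.range (3 * n + 2), 576 ^ (n + 1) * ‖x - 1‖ ^ (2 * n + 1) := by
        refine norm_sum_le_of_le _ fun j _ => ?_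
        rcases le_or_gt j (2 * n) with h | h
        · rw [coeff_padeRem_comp_eq_zero h, zero_mul, norm_zero]; positivity
        · rw [norm_mul, norm_pow]
          exact mul_le_mul (norm_coeff_padeRem_comp_le n j)
            (pow_le_pow_of_le_one (norm_nonneg _) hx h) (by positivity) (by positivity)
    _ = (3 * n + 2 : ℕ) * 576 ^ (n + 1) * ‖x - 1‖ ^ (2 * n + 1) := by
        rw [Finset.sum_const, Finset.card_range, nsmul_eq_mul, mul_assoc]
    _ ≤ (4 ^ (n + 1) : ℕ) * 576 ^ (n + 1) * ‖x - 1‖ ^ (2 * n + 1) := by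
        gcongr
    _ = 2304 ^ (n + 1) * ‖x - 1‖ ^ (2 * n + 1) := by
        push_cast; rw [← mul_pow]; norm_num

lemma norm_eval_padeNum_le (n : ℕ) {t : ℂ} (ht : ‖t‖ ≤ 8) :
    ‖(padeNum n).eval t‖ ≤ 2304 ^ (n + 1) := by
  rw [eval_padeNum]
  calc _ ≤ ∑ k ∈ Finset.range (n + 1), (36 ^ (n + 1) * 8 ^ n : ℝ) := by
        refine norm_sum_le_of_le _ fun k hk => ?_
        have hk : k ≤ n := by simpa [Nat.lt_succ_iff] using hk
        rw [norm_mul, norm_pow, Complex.norm_natCast]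
        have h := padeCoeff_le k (n - k)
        rw [Nat.add_sub_cancel' hk] at h
        refine mul_le_mul (by exact_mod_cast h) ?_ (by positivity) (by positivity)
        calc ‖t‖ ^ k ≤ 8 ^ k := by gcongr
          _ ≤ 8 ^ n := pow_le_pow_right₀ (by norm_num) hk
    _ = (n + 1 : ℕ) * (36 ^ (n + 1) * 8 ^ n) := by simp
    _ ≤ (2 ^ (n + 1) : ℕ) * (36 ^ (n + 1) * 8 ^ (n + 1)) := by
        gcongr
        · exact (Nat.lt_two_pow_self).le
        · norm_num
        · omega
    _ = 576 ^ (n + 1) := by push_cast; rw [← mul_pow, ← mul_pow]; norm_num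
    _ ≤ 2304 ^ (n + 1) := by gcongr; norm_num

/-- The cross-determinant of consecutive Padé approximants. -/
def padeWronskian (n : ℕ) : Polynomial ℂ :=
  padeDen n * padeNum (n + 1) - padeDen (n + 1) * padeNum n

lemma natDegree_padeWronskian_le (n : ℕ) : (padeWronskian n).natDegree ≤ 2 * n + 1 := by
  have h1 := natDegree_padeDen_le n
  have h2 := natDegree_padeDen_le (n + 1)
  have h3 := natDegree_padeNum_le n
  have h4 := natDegree_padeNum_le (n + 1)
  refine (Polynomial.natDegree_sub_le _ _).trans (max_le ?_ ?_) <;>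
  · refine Polynomial.natDegree_mul_le.trans ?_
    omega

lemma padeCoeff_zero_right (n : ℕ) :
    (padeCoeff n 0 : ℚ) * n.factorial = 3 ^ n * ∏ i ∈ Finset.range n, (3 * i + 4 : ℚ) := by
  have := congrArg (Nat.cast : ℕ → ℚ) (padeCoeff_mul_factorial n 0)
  simpa using this

lemma padeCoeff_zero_left (n : ℕ) :
    (padeCoeff 0 n : ℚ) * n.factorial = 3 ^ n * ∏ i ∈ Finset.range n, (3 * i + 2 : ℚ) := by
  have := congrArg (Nat.cast : ℕ → ℚ) (padeCoeff_mul_factorial 0 n)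
  simpa using this

lemma padeCoeff_cross_ne (n : ℕ) :
    padeCoeff n 0 * padeCoeff 0 (n + 1) ≠ padeCoeff (n + 1) 0 * padeCoeff 0 n := by
  intro h
  have h' : (padeCoeff n 0 * padeCoeff 0 (n + 1) : ℚ) = padeCoeff (n + 1) 0 * padeCoeff 0 n := by
    exact_mod_cast h
  have a1 := padeCoeff_zero_right n
  have a2 := padeCoeff_zero_right (n + 1)
  have b1 := padeCoeff_zero_left n
  have b2 := padeCoeff_zero_left (n + 1)
  rw [Finset.prod_range_succ] at a2 b2
  have hP : ∏ i ∈ Finset.range n, (3 * i + 4 : ℚ) ≠ 0 := by positivity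
  have hQ : ∏ i ∈ Finset.range n, (3 * i + 2 : ℚ) ≠ 0 := by positivity
  set P := ∏ i ∈ Finset.range n, (3 * i + 4 : ℚ)
  set Q := ∏ i ∈ Finset.range n, (3 * i + 2 : ℚ)
  have key : (3 ^ n * P) * (3 ^ (n + 1) * (Q * (3 * n + 2))) =
      (3 ^ (n + 1) * (P * (3 * n + 4))) * (3 ^ n * Q) := by
    rw [← a1, ← a2, ← b1, ← b2]
    linear_combination (n.factorial * (n + 1).factorial : ℚ) * h'
  have h3 : (3 ^ n * 3 ^ (n + 1) * P * Q : ℚ) ≠ 0 := by positivity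
  have : (3 * n + 2 : ℚ) = 3 * n + 4 := by
    apply mul_left_cancel₀ h3
    linear_combination key
  linarith

lemma eval_zero_padeWronskian_ne_zero (n : ℕ) : (padeWronskian n).eval 0 ≠ 0 := by
  have e1 (m : ℕ) : (padeDen m).eval 0 = padeCoeff m 0 := by
    rw [eval_padeDen, Finset.sum_range_succ']; simp
  have e2 (m : ℕ) : (padeNum m).eval 0 = padeCoeff 0 m := by
    rw [eval_padeNum, Finset.sum_range_succ']; simp
  rw [padeWronskian, Polynomial.eval_sub, Polynomial.eval_mul, Polynomial.eval_mul, e1, e1, e2, e2,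
    sub_ne_zero]
  exact_mod_cast padeCoeff_cross_ne n

lemma X_sub_one_pow_dvd_of_comp_cube {W : Polynomial ℂ} (hW : W ≠ 0) {m : ℕ}
    (h : (Polynomial.X - Polynomial.C 1) ^ m ∣ Polynomial.X * W.comp (Polynomial.X ^ 3)) :
    (Polynomial.X - Polynomial.C 1) ^ m ∣ W := by
  obtain ⟨V, hV, hndvd⟩ := Polynomial.exists_eq_pow_rootMultiplicity_mul_and_not_dvd W hW 1
  set k := W.rootMultiplicity 1
  rw [Polynomial.dvd_iff_isRoot, Polynomial.IsRoot] at hndvd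
  by_contra hcon
  have hk : k < m := by
    by_contra hk
    exact hcon ((pow_dvd_pow _ (not_lt.1 hk)).trans ⟨V, hV⟩)
  have hfac : Polynomial.X * W.comp (Polynomial.X ^ 3) =
      (Polynomial.X - Polynomial.C 1) ^ k * (Polynomial.X *
        (Polynomial.X ^ 2 + Polynomial.X + 1) ^ k * V.comp (Polynomial.X ^ 3)) := by
    rw [hV]
    simp only [Polynomial.mul_comp, Polynomial.pow_comp, Polynomial.sub_comp, Polynomial.X_comp,
      Polynomial.C_comp]
    rw [show (Polynomial.X ^ 3 - Polynomial.C 1 : Polynomial ℂ) =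
      (Polynomial.X - Polynomial.C 1) * (Polynomial.X ^ 2 + Polynomial.X + 1) by
        rw [Polynomial.C_1]; ring, mul_pow]
    ring
  rw [hfac, ← Nat.add_sub_cancel' hk.le, pow_add] at h
  have h0 : (Polynomial.X - Polynomial.C (1 : ℂ)) ^ k ≠ 0 :=
    pow_ne_zero _ (Polynomial.X_sub_C_ne_zero 1)
  have h1 := (dvd_pow_self _ (Nat.sub_pos_of_lt hk).ne').trans ((mul_dvd_mul_iff_left h0).1 h)
  rw [Polynomial.dvd_iff_isRoot, Polynomial.IsRoot] at h1
  simp only [Polynomial.eval_mul, Polynomial.eval_pow, Polynomial.eval_add, Polynomial.eval_X,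
    Polynomial.eval_one, Polynomial.eval_comp, one_pow, mul_eq_zero] at h1
  rcases h1 with (h1 | h1) | h1
  · norm_num at h1
  · norm_num at h1
  · exact hndvd h1

lemma eval_padeWronskian_ne_zero (n : ℕ) {t : ℂ} (ht : t ≠ 1) : (padeWronskian n).eval t ≠ 0 := by
  have hW : padeWronskian n ≠ 0 := by
    intro h; apply eval_zero_padeWronskian_ne_zero n; rw [h, Polynomial.eval_zero]
  have hdvd : (Polynomial.X - Polynomial.C 1) ^ (2 * n + 1) ∣
      Polynomial.X * (padeWronskian n).comp (Polynomial.X ^ 3) := by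
    have : Polynomial.X * (padeWronskian n).comp (Polynomial.X ^ 3) =
        padeRem n * (padeNum (n + 1)).comp (Polynomial.X ^ 3) -
          padeRem (n + 1) * (padeNum n).comp (Polynomial.X ^ 3) := by
      simp only [padeWronskian, padeRem, Polynomial.sub_comp, Polynomial.mul_comp]; ring
    rw [this]
    exact dvd_sub ((X_sub_one_pow_dvd_padeRem n).mul_right _)
      (((pow_dvd_pow _ (by omega)).trans (X_sub_one_pow_dvd_padeRem (n + 1))).mul_right _)
  obtain ⟨V, hV⟩ := X_sub_one_pow_dvd_of_comp_cube hW hdvd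
  have hV0 : V ≠ 0 := by rintro rfl; exact hW (by rw [hV, mul_zero])
  have hdeg := natDegree_padeWronskian_le n
  rw [hV, Polynomial.natDegree_mul (pow_ne_zero _ (Polynomial.X_sub_C_ne_zero 1)) hV0,
    Polynomial.natDegree_pow, Polynomial.natDegree_X_sub_C] at hdeg
  have hVC := Polynomial.eq_C_of_natDegree_eq_zero (p := V) (by omega)
  rw [hVC, Polynomial.C_ne_zero] at hV0
  rw [hV, hVC]
  simp [sub_ne_zero.2 ht, hV0]

/-- `x` and `y` are of the form `u + v * s` and `u - v * s` with integers `u` and `v`. -/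
def ConjPair (s x y : ℂ) : Prop := ∃ u v : ℤ, x = u + v * s ∧ y = u - v * s

namespace ConjPair

variable {s x y x' y' : ℂ}

lemma symm (h : ConjPair s x y) : ConjPair s y x := by
  obtain ⟨u, v, rfl, rfl⟩ := h
  exact ⟨u, -v, by push_cast; ring, by push_cast; ring⟩

lemma intCast (n : ℤ) : ConjPair s n n := ⟨n, 0, by simp, by simp⟩

lemma add (h : ConjPair s x y) (h' : ConjPair s x' y') : ConjPair s (x + x') (y + y') := by
  obtain ⟨u, v, rfl, rfl⟩ := h
  obtain ⟨u', v', rfl, rfl⟩ := h'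
  exact ⟨u + u', v + v', by push_cast; ring, by push_cast; ring⟩

lemma mul {d : ℤ} (hd : s ^ 2 = d) (h : ConjPair s x y) (h' : ConjPair s x' y') :
    ConjPair s (x * x') (y * y') := by
  obtain ⟨u, v, rfl, rfl⟩ := h
  obtain ⟨u', v', rfl, rfl⟩ := h'
  refine ⟨u * u' + v * v' * d, u * v' + u' * v, ?_, ?_⟩ <;>
  · push_cast
    linear_combination (v * v' : ℂ) * hd

lemma int_mul (n : ℤ) (h : ConjPair s x y) : ConjPair s (n * x) (n * y) := by
  obtain ⟨u, v, rfl, rfl⟩ := h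
  exact ⟨n * u, n * v, by push_cast; ring, by push_cast; ring⟩

lemma pow {d : ℤ} (hd : s ^ 2 = d) (h : ConjPair s x y) (n : ℕ) :
    ConjPair s (x ^ n) (y ^ n) := by
  induction n with
  | zero => simpa using intCast (s := s) 1
  | succ n ih => rw [pow_succ, pow_succ]; exact ih.mul hd h

lemma sum {ι : Type*} (t : Finset ι) {f g : ι → ℂ} (h : ∀ i ∈ t, ConjPair s (f i) (g i)) :
    ConjPair s (∑ i ∈ t, f i) (∑ i ∈ t, g i) := by
  classical
  induction t using Finset.induction_on with
  | empty => simpa using intCast (s := s) 0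
  | insert a t ha ih =>
    rw [Finset.sum_insert ha, Finset.sum_insert ha]
    exact (h a (Finset.mem_insert_self a t)).add
      (ih fun i hi => h i (Finset.mem_insert_of_mem hi))

lemma le_norm_sub (h : ConjPair s x y) (hne : x - y ≠ 0) : 2 * ‖s‖ ≤ ‖x - y‖ := by
  obtain ⟨u, v, rfl, rfl⟩ := h
  have e : (u + v * s - (u - v * s) : ℂ) = 2 * v * s := by ring
  rw [e] at hne ⊢
  have hv : v ≠ 0 := by rintro rfl; simp at hne
  rw [norm_mul, norm_mul, Complex.norm_intCast, Complex.norm_ofNat]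
  have : (1 : ℝ) ≤ |(v : ℝ)| := by exact_mod_cast Int.one_le_abs hv
  nlinarith [norm_nonneg s]

end ConjPair

/-- The homogenized Padé form `U * X ^ n * A (Y / X) - V * X ^ n * B (Y / X)`. -/
def padeForm (n : ℕ) (U V X Y : ℂ) : ℂ :=
  U * (∑ k ∈ Finset.range (n + 1), (padeCoeff (n - k) k : ℂ) * (Y ^ k * X ^ (n - k))) -
    V * ∑ k ∈ Finset.range (n + 1), (padeCoeff k (n - k) : ℂ) * (Y ^ k * X ^ (n - k))

lemma padeForm_eq (n : ℕ) (U V : ℂ) {X : ℂ} (Y : ℂ) (hX : X ≠ 0) :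
    padeForm n U V X Y =
      X ^ n * (U * (padeDen n).eval (Y / X) - V * (padeNum n).eval (Y / X)) := by
  have h (f : ℕ → ℂ) : ∑ k ∈ Finset.range (n + 1), f k * (Y ^ k * X ^ (n - k)) =
      X ^ n * ∑ k ∈ Finset.range (n + 1), f k * (Y / X) ^ k := by
    rw [Finset.mul_sum]
    refine Finset.sum_congr rfl fun k hk => ?_
    have hk : k ≤ n := by simpa [Nat.lt_succ_iff] using hk
    rw [div_pow, ← Nat.sub_add_cancel hk, pow_add]
    simp only [Nat.add_sub_cancel]
    field_simp
  rw [padeForm, h, h, eval_padeDen, eval_padeNum]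
  ring

lemma le_norm_padeForm {s : ℂ} {d : ℤ} (hd : s ^ 2 = d) {U V X Y : ℂ} (hUV : ConjPair s U V)
    (hXY : ConjPair s X Y) (n : ℕ) (hne : padeForm n U V X Y ≠ 0) :
    2 * ‖s‖ ≤ ‖padeForm n U V X Y‖ := by
  refine ConjPair.le_norm_sub (hUV.mul hd ?_) hne
  rw [← Finset.sum_range_reflect (fun k => (padeCoeff k (n - k) : ℂ) * (Y ^ k * X ^ (n - k)))]
  refine ConjPair.sum _ fun k hk => ?_
  have hk : k ≤ n := by simpa [Nat.lt_succ_iff] using hk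
  rw [Nat.add_sub_cancel, Nat.sub_sub_self hk, mul_comm (Y ^ (n - k))]
  exact_mod_cast ConjPair.int_mul (padeCoeff (n - k) k)
    (((hXY.symm).pow hd k).mul hd (hXY.pow hd (n - k)))

lemma padeForm_ne_zero_or (n : ℕ) {U V X Y : ℂ} (hU : U ≠ 0) (hX : X ≠ 0) (hXY : X ≠ Y) :
    padeForm n U V X Y ≠ 0 ∨ padeForm (n + 1) U V X Y ≠ 0 := by
  by_contra! h
  obtain ⟨h1, h2⟩ := h
  rw [padeForm_eq _ _ _ _ hX, mul_eq_zero, or_iff_right (pow_ne_zero _ hX)] at h1 h2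
  refine eval_padeWronskian_ne_zero n (t := Y / X) ?_ ?_
  · rw [Ne, div_eq_one_iff_eq hX]; exact hXY.symm
  · apply mul_left_cancel₀ hU
    rw [padeWronskian, Polynomial.eval_sub, Polynomial.eval_mul, Polynomial.eval_mul]
    linear_combination (padeNum (n + 1)).eval (Y / X) * h1 - (padeNum n).eval (Y / X) * h2

lemma norm_padeForm_le (n κ : ℕ) {c : ℝ} (hc : 1 ≤ c) {ω X Y X' Y' : ℂ} (hω : ω ^ 3 = 1)
    (hX : X ≠ 0) (hX' : X' ≠ 0) (hcX : c ≤ ‖X‖ ^ 3)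
    (h : ‖X - ω * Y‖ ≤ c / ‖X‖ ^ 2) (h' : ‖X' - ω * Y'‖ ≤ c / ‖X'‖ ^ 2) :
    ‖padeForm n (κ * (X' * Y)) (κ * (Y' * X)) (κ * X ^ 3) (κ * Y ^ 3)‖ ≤
      (2304 * κ * c ^ 2) ^ (n + 1) *
        (‖X'‖ / ‖X‖ ^ (3 * n + 2) + ‖X‖ ^ (3 * n + 1) / ‖X'‖ ^ 2) := by
  rcases Nat.eq_zero_or_pos κ with rfl | hκ
  · simp [padeForm]
  have hκ' : (κ : ℂ) ≠ 0 := by exact_mod_cast hκ.ne'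
  have hω0 : ω ≠ 0 := by rintro rfl; norm_num at hω
  have hω1 : ‖ω‖ = 1 := by
    have : ‖ω‖ ^ 3 = 1 := by rw [← norm_pow, hω, norm_one]
    exact (pow_eq_one_iff_of_nonneg (norm_nonneg _) (by norm_num)).1 this
  have hXp : 0 < ‖X‖ := norm_pos_iff.2 hX
  have hXp' : 0 < ‖X'‖ := norm_pos_iff.2 hX'
  set x := ω * Y / X with hx
  have hx3 : (κ * Y ^ 3) / (κ * X ^ 3) = x ^ 3 := by
    rw [hx, mul_div_mul_left _ _ hκ', div_pow, mul_pow, hω, one_mul]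
  have hx1 : ‖x - 1‖ ≤ c / ‖X‖ ^ 3 := by
    have : x - 1 = -(X - ω * Y) / X := by rw [hx]; field_simp; ring
    rw [this, norm_div, norm_neg, div_le_iff₀ hXp]
    refine h.trans_eq ?_
    field_simp
  have hx1' : ‖x - 1‖ ≤ 1 := hx1.trans ((div_le_one (by positivity)).2 hcX)
  have hx2 : ‖x‖ ≤ 2 := by
    calc ‖x‖ = ‖(x - 1) + 1‖ := by ring_nf
      _ ≤ ‖x - 1‖ + ‖(1 : ℂ)‖ := norm_add_le _ _
      _ ≤ 2 := by rw [norm_one]; linarith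
  have hx8 : ‖x ^ 3‖ ≤ 8 := by
    rw [norm_pow]
    calc ‖x‖ ^ 3 ≤ 2 ^ 3 := by gcongr
      _ = 8 := by norm_num
  have hform : padeForm n (κ * (X' * Y)) (κ * (Y' * X)) (κ * X ^ 3) (κ * Y ^ 3) =
      κ ^ (n + 1) * X ^ (3 * n + 1) * ω⁻¹ *
        (X' * (padeRem n).eval x + (X' - ω * Y') * (padeNum n).eval (x ^ 3)) := by
    rw [padeForm_eq _ _ _ _ (mul_ne_zero hκ' (pow_ne_zero _ hX)), hx3, eval_padeRem]
    have hY : Y = ω⁻¹ * x * X := by rw [hx]; field_simp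
    have hX3 : (X ^ 3) ^ n * X = X ^ (3 * n + 1) := by ring
    rw [hY, mul_pow, ← hX3, pow_succ (κ : ℂ) n]
    field_simp
    ring
  have hR := norm_eval_padeRem_le n hx1'
  have hN := norm_eval_padeNum_le n hx8
  rw [hform, norm_mul, norm_mul, norm_mul, norm_inv, hω1, inv_one, mul_one, norm_pow, norm_pow,
    Complex.norm_natCast]
  have hc2 : c ^ (2 * n + 1) ≤ (c ^ 2) ^ (n + 1) := by
    rw [← pow_mul]; exact pow_le_pow_right₀ hc (by omega)
  have hc1 : c ≤ (c ^ 2) ^ (n + 1) := by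
    rw [← pow_mul]; exact le_self_pow₀ hc (by omega)
  have b1 : ‖X' * (padeRem n).eval x‖ ≤
      ‖X'‖ * (2304 ^ (n + 1) * ((c ^ 2) ^ (n + 1) / (‖X‖ ^ 3) ^ (2 * n + 1))) := by
    rw [norm_mul]
    gcongr
    refine hR.trans ?_
    gcongr
    calc ‖x - 1‖ ^ (2 * n + 1) ≤ (c / ‖X‖ ^ 3) ^ (2 * n + 1) := by gcongr
      _ = c ^ (2 * n + 1) / (‖X‖ ^ 3) ^ (2 * n + 1) := div_pow _ _ _
      _ ≤ _ := by gcongr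
  have b2 : ‖(X' - ω * Y') * (padeNum n).eval (x ^ 3)‖ ≤
      (c ^ 2) ^ (n + 1) / ‖X'‖ ^ 2 * 2304 ^ (n + 1) := by
    rw [norm_mul]
    gcongr
    exact h'.trans (by gcongr)
  calc _ ≤ (κ : ℝ) ^ (n + 1) * ‖X‖ ^ (3 * n + 1) *
        (‖X'‖ * (2304 ^ (n + 1) * ((c ^ 2) ^ (n + 1) / (‖X‖ ^ 3) ^ (2 * n + 1))) +
          (c ^ 2) ^ (n + 1) / ‖X'‖ ^ 2 * 2304 ^ (n + 1)) := by
        gcongr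
        exact (norm_add_le _ _).trans (add_le_add b1 b2)
    _ = (2304 * κ * c ^ 2) ^ (n + 1) *
        (‖X'‖ * (‖X‖ ^ (3 * n + 1) / (‖X‖ ^ 3) ^ (2 * n + 1)) +
          ‖X‖ ^ (3 * n + 1) / ‖X'‖ ^ 2) := by
        rw [mul_pow, mul_pow]; ring
    _ = _ := by
        congr 2
        rw [← pow_mul, show 3 * (2 * n + 1) = (3 * n + 2) + (3 * n + 1) by ring, pow_add]
        field_simp
        ring

/-- The gap between two solutions that approximate the same cube root of unity is bounded. -/
lemma norm_lt_of_norm_sub_le {s : ℂ} {d : ℤ} (hd : s ^ 2 = d) {κ : ℕ} (hκ : 0 < κ)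
    {c K : ℝ} (hc : 1 ≤ c) (hK : 2304 * κ * c ^ 2 ≤ K) (hKs : 1 < K * ‖s‖)
    {ω X Y X' Y' : ℂ} (hω : ω ^ 3 = 1) (hXY : X ^ 3 ≠ Y ^ 3) (hY : Y ≠ 0)
    (hKX : K ^ 9 ≤ ‖X‖)
    (h : ‖X - ω * Y‖ ≤ c / ‖X‖ ^ 2) (h' : ‖X' - ω * Y'‖ ≤ c / ‖X'‖ ^ 2)
    (hcube : ConjPair s (κ * X ^ 3) (κ * Y ^ 3))
    (hmix : ConjPair s (κ * (X' * Y)) (κ * (Y' * X))) :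
    ‖X'‖ < ‖X‖ ^ 10 := by
  by_contra! hbig
  have hκ1 : (1 : ℝ) ≤ κ := by exact_mod_cast hκ
  have hcK : 2 * c ≤ K := by nlinarith [mul_le_mul hκ1 hc (by linarith) (by linarith)]
  have hK2 : 2 ≤ K := by linarith
  have hK1 : 1 ≤ K := by linarith
  have hKX' : K ≤ ‖X‖ := (le_self_pow₀ hK1 (by norm_num)).trans hKX
  have hX1 : 1 < ‖X‖ := by linarith
  have hXp : 0 < ‖X‖ := by linarith
  have hX'1 : 1 < ‖X'‖ := (one_lt_pow₀ hX1 (by norm_num)).trans_le hbig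
  have hX'p : 0 < ‖X'‖ := by linarith
  have hX : X ≠ 0 := norm_pos_iff.1 hXp
  have hX' : X' ≠ 0 := norm_pos_iff.1 hX'p
  have hκ' : (κ : ℂ) ≠ 0 := by exact_mod_cast hκ.ne'
  obtain ⟨n, hn1, hn2⟩ := exists_nat_pow_near hX'1.le (one_lt_pow₀ hX1 two_ne_zero)
  have hn5 : 5 ≤ n := by
    by_contra! hn
    have : (‖X‖ ^ 2) ^ (n + 1) ≤ ‖X‖ ^ 10 := by
      rw [← pow_mul]; exact pow_le_pow_right₀ hX1.le (by omega)
    linarith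
  have hKpow {i j : ℕ} (hij : i ≤ 9 * j) : K ^ i ≤ ‖X‖ ^ j := by
    calc K ^ i ≤ K ^ (9 * j) := pow_le_pow_right₀ hK1 hij
      _ = (K ^ 9) ^ j := pow_mul _ _ _
      _ ≤ ‖X‖ ^ j := by gcongr
  have key : ∀ m, n ≤ m → m ≤ n + 1 →
      padeForm m (κ * (X' * Y)) (κ * (Y' * X)) (κ * X ^ 3) (κ * Y ^ 3) = 0 := by
    intro m hm1 hm2
    by_contra hne
    have hlow := le_norm_padeForm hd hmix hcube m hne
    have hup := norm_padeForm_le m κ hc hω hX hX'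
      (by linarith [le_self_pow₀ hX1.le (n := 3) (by norm_num)]) h h'
    have t1 : K ^ (m + 1) * (‖X'‖ / ‖X‖ ^ (3 * m + 2)) ≤ 1 / K := by
      rw [mul_div_assoc', div_le_div_iff₀ (by positivity) (by positivity)]
      calc K ^ (m + 1) * ‖X'‖ * K = K ^ (m + 2) * ‖X'‖ := by ring
        _ ≤ ‖X‖ ^ m * (‖X‖ ^ 2) ^ (n + 1) := by
          have := hKpow (i := m + 2) (j := m) (by omega)
          gcongr
        _ = ‖X‖ ^ (m + 2 * (n + 1)) := by rw [← pow_mul, pow_add]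
        _ ≤ ‖X‖ ^ (3 * m + 2) := pow_le_pow_right₀ hX1.le (by omega)
        _ = _ := by ring
    have t2 : K ^ (m + 1) * (‖X‖ ^ (3 * m + 1) / ‖X'‖ ^ 2) ≤ 1 / K := by
      rw [mul_div_assoc', div_le_div_iff₀ (by positivity) (by positivity)]
      calc K ^ (m + 1) * ‖X‖ ^ (3 * m + 1) * K = K ^ (m + 2) * ‖X‖ ^ (3 * m + 1) := by ring
        _ ≤ ‖X‖ ^ (4 * n - 3 * m - 1) * ‖X‖ ^ (3 * m + 1) := by
          have := hKpow (i := m + 2) (j := 4 * n - 3 * m - 1) (by omega)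
          gcongr
        _ = ‖X‖ ^ (4 * n) := by rw [← pow_add]; congr 1; omega
        _ = ((‖X‖ ^ 2) ^ n) ^ 2 := by rw [← pow_mul, ← pow_mul]; congr 1; omega
        _ ≤ ‖X'‖ ^ 2 := by gcongr
        _ = _ := by ring
    have t3 : (2304 * κ * c ^ 2) ^ (m + 1) *
        (‖X'‖ / ‖X‖ ^ (3 * m + 2) + ‖X‖ ^ (3 * m + 1) / ‖X'‖ ^ 2) ≤ 2 / K := by
      calc _ ≤ K ^ (m + 1) *
          (‖X'‖ / ‖X‖ ^ (3 * m + 2) + ‖X‖ ^ (3 * m + 1) / ‖X'‖ ^ 2) := by gcongr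
        _ ≤ 1 / K + 1 / K := by rw [mul_add]; exact add_le_add t1 t2
        _ = 2 / K := by ring
    have t4 : 2 / K < 2 * ‖s‖ := by rw [div_lt_iff₀ (by positivity)]; linarith
    linarith
  rcases padeForm_ne_zero_or n (U := κ * (X' * Y)) (V := κ * (Y' * X)) (X := κ * X ^ 3)
    (Y := κ * Y ^ 3) (mul_ne_zero hκ' (mul_ne_zero hX' hY)) (mul_ne_zero hκ' (pow_ne_zero _ hX))
    (fun he => hXY (mul_left_cancel₀ hκ' he)) with h1 | h1
  · exact h1 (key n le_rfl (by omega))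
  · exact h1 (key (n + 1) (by omega) le_rfl)

lemma norm_sub_mul_sq_le {X Y : ℂ} (h : ‖X - Y‖ ≤ ‖Y‖ / 2) :
    ‖X - Y‖ * ‖Y‖ ^ 2 ≤ ‖X ^ 3 - Y ^ 3‖ := by
  have e : X ^ 3 - Y ^ 3 = (X - Y) * (X ^ 2 + X * Y + Y ^ 2) := by ring
  rw [e, norm_mul]
  gcongr
  have e2 : (3 : ℂ) * Y ^ 2 = (X ^ 2 + X * Y + Y ^ 2) - (X - Y) * (3 * Y) - (X - Y) ^ 2 := by ring
  have h1 : ‖(3 : ℂ) * Y ^ 2‖ = 3 * ‖Y‖ ^ 2 := by simp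
  have h2 : ‖(X - Y) * (3 * Y)‖ = 3 * (‖X - Y‖ * ‖Y‖) := by simp; ring
  have h3 : ‖(X - Y) ^ 2‖ = ‖X - Y‖ ^ 2 := norm_pow _ _
  have h4 := norm_sub_le ((X ^ 2 + X * Y + Y ^ 2) - (X - Y) * (3 * Y)) ((X - Y) ^ 2)
  have h5 := norm_sub_le (X ^ 2 + X * Y + Y ^ 2) ((X - Y) * (3 * Y))
  rw [← e2, h1, h3] at h4
  rw [h2] at h5
  nlinarith [norm_nonneg (X - Y), norm_nonneg Y]

lemma exists_cube_root_near {X Y : ℂ} (h : 8 * ‖X ^ 3 - Y ^ 3‖ < ‖Y‖ ^ 3) {ζ : ℂ}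
    (hζ : ζ ^ 2 + ζ + 1 = 0) :
    ∃ i ∈ Finset.range 3, ‖X - ζ ^ i * Y‖ ≤ ‖Y‖ / 2 := by
  by_contra! hcon
  have h0 := hcon 0 (by simp)
  have h1 := hcon 1 (by simp)
  have h2 := hcon 2 (by simp)
  have e : X ^ 3 - Y ^ 3 = (X - ζ ^ 0 * Y) * (X - ζ ^ 1 * Y) * (X - ζ ^ 2 * Y) := by
    linear_combination (X ^ 2 * Y - ζ * X * Y ^ 2 + (ζ - 1) * Y ^ 3) * hζ
  rw [e, norm_mul, norm_mul] at h
  have hY := norm_nonneg Y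
  have : (‖Y‖ / 2) * (‖Y‖ / 2) * (‖Y‖ / 2) ≤
      ‖X - ζ ^ 0 * Y‖ * ‖X - ζ ^ 1 * Y‖ * ‖X - ζ ^ 2 * Y‖ := by gcongr
  nlinarith

lemma finite_norm_le {x₁ x₂ y₁ y₂ : ℂ} (hdet : x₁ * y₂ - x₂ * y₁ ≠ 0) (B : ℝ) :
    {v : ℤ × ℤ | ‖x₁ * v.1 + x₂ * v.2‖ ≤ B ∧ ‖y₁ * v.1 + y₂ * v.2‖ ≤ B}.Finite := by
  have hD : 0 < ‖x₁ * y₂ - x₂ * y₁‖ := norm_pos_iff.2 hdet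
  have hbound (x y u t : ℂ) (q : ℤ) (h : (x₁ * y₂ - x₂ * y₁) * q = x * u + y * t)
      (hu : ‖u‖ ≤ B) (ht : ‖t‖ ≤ B) :
      |(q : ℝ)| ≤ (‖x‖ * B + ‖y‖ * B) / ‖x₁ * y₂ - x₂ * y₁‖ := by
    rw [le_div_iff₀ hD, mul_comm, ← Complex.norm_intCast, ← norm_mul, h]
    refine (norm_add_le _ _).trans ?_
    rw [norm_mul, norm_mul]
    gcongr
  set M := max ((‖y₂‖ * B + ‖-x₂‖ * B) / ‖x₁ * y₂ - x₂ * y₁‖)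
    ((‖-y₁‖ * B + ‖x₁‖ * B) / ‖x₁ * y₂ - x₂ * y₁‖) with hM
  refine ((Set.finite_Icc (-⌈M⌉) ⌈M⌉).prod (Set.finite_Icc (-⌈M⌉) ⌈M⌉)).subset ?_
  rintro ⟨p, q⟩ ⟨h1, h2⟩
  have hint (r : ℤ) (hr : |(r : ℝ)| ≤ M) : r ∈ Set.Icc (-⌈M⌉) ⌈M⌉ := by
    have : |(r : ℝ)| ≤ ⌈M⌉ := hr.trans (Int.le_ceil M)
    exact abs_le.1 (by exact_mod_cast this)
  refine ⟨hint p ((hbound y₂ (-x₂) _ _ p ?_ h1 h2).trans (le_max_left _ _)),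
    hint q ((hbound (-y₁) x₁ _ _ q ?_ h1 h2).trans (le_max_right _ _))⟩ <;> ring

/-- Finiteness of the solutions of a diagonalized cubic Thue equation. -/
theorem finite_cube_sub_cube_eq {s : ℂ} {d : ℤ} (hs : s ≠ 0) (hd : s ^ 2 = d) {κ : ℕ}
    (hκ : 0 < κ) {x₁ x₂ y₁ y₂ δ : ℂ} (hdet : x₁ * y₂ - x₂ * y₁ ≠ 0) (hδ : δ ≠ 0)
    (hcube : ∀ p q : ℤ,
      ConjPair s (κ * (x₁ * p + x₂ * q) ^ 3) (κ * (y₁ * p + y₂ * q) ^ 3))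
    (hmix : ∀ p q p' q' : ℤ, ConjPair s (κ * ((x₁ * p' + x₂ * q') * (y₁ * p + y₂ * q)))
      (κ * ((y₁ * p' + y₂ * q') * (x₁ * p + x₂ * q)))) :
    {v : ℤ × ℤ | (x₁ * v.1 + x₂ * v.2) ^ 3 - (y₁ * v.1 + y₂ * v.2) ^ 3 = δ}.Finite := by
  set X : ℤ × ℤ → ℂ := fun v => x₁ * v.1 + x₂ * v.2 with hXdef
  set Y : ℤ × ℤ → ℂ := fun v => y₁ * v.1 + y₂ * v.2 with hYdef
  set S := {v : ℤ × ℤ | X v ^ 3 - Y v ^ 3 = δ} with hS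
  change S.Finite
  have hY_le (v) (hv : v ∈ S) (B : ℝ) (hB : ‖δ‖ + 1 ≤ B) (hX : ‖X v‖ ≤ B) : ‖Y v‖ ≤ 2 * B := by
    have e : Y v ^ 3 = X v ^ 3 - δ := by rw [← show X v ^ 3 - Y v ^ 3 = δ from hv]; ring
    have h1 : ‖Y v‖ ^ 3 ≤ ‖X v‖ ^ 3 + ‖δ‖ := by
      rw [← norm_pow, e, ← norm_pow]; exact norm_sub_le _ _
    have hB1 : 1 ≤ B := by linarith [norm_nonneg δ]
    have h2 : ‖Y v‖ ^ 3 ≤ (2 * B) ^ 3 := by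
      have : ‖X v‖ ^ 3 ≤ B ^ 3 := by gcongr
      have : B ≤ B ^ 3 := le_self_pow₀ hB1 (by norm_num)
      nlinarith
    exact le_of_pow_le_pow_left₀ (by norm_num) (by linarith) h2
  have hfinX (B : ℝ) : {v ∈ S | ‖X v‖ ≤ B}.Finite := by
    refine (finite_norm_le hdet (2 * max B (‖δ‖ + 1))).subset ?_
    rintro ⟨p, q⟩ ⟨hv, hB⟩
    have hm := le_max_right B (‖δ‖ + 1)
    have hB' := hB.trans (le_max_left B (‖δ‖ + 1))
    exact ⟨by linarith [norm_nonneg δ], hY_le _ hv _ hm hB'⟩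
  obtain ⟨ζ, hζ⟩ : ∃ ζ : ℂ, ζ ^ 2 + ζ + 1 = 0 := by
    obtain ⟨r, hr⟩ := IsAlgClosed.exists_pow_nat_eq (-3 : ℂ) (n := 2) (by norm_num)
    exact ⟨(-1 + r) / 2, by linear_combination hr / 4⟩
  have hζ3 : ζ ^ 3 = 1 := by linear_combination (ζ - 1) * hζ
  set c : ℝ := 3 * ‖δ‖ + 1 with hc
  have hc1 : 1 ≤ c := by linarith [norm_nonneg δ]
  have happrox (ω : ℂ) (hω : ω ^ 3 = 1) (v) (hv : v ∈ S) (hX : X v ≠ 0)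
      (h : ‖X v - ω * Y v‖ ≤ ‖Y v‖ / 2) : ‖X v - ω * Y v‖ ≤ c / ‖X v‖ ^ 2 := by
    have hω1 : ‖ω‖ = 1 := by
      have : ‖ω‖ ^ 3 = 1 := by rw [← norm_pow, hω, norm_one]
      exact (pow_eq_one_iff_of_nonneg (norm_nonneg _) (by norm_num)).1 this
    have hn : ‖ω * Y v‖ = ‖Y v‖ := by rw [norm_mul, hω1, one_mul]
    have h1 := norm_sub_mul_sq_le (X := X v) (Y := ω * Y v) (by rwa [hn])
    rw [mul_pow, hω, one_mul, show X v ^ 3 - Y v ^ 3 = δ from hv, hn] at h1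
    have h2 : ‖X v‖ ≤ 3 / 2 * ‖Y v‖ := by
      calc ‖X v‖ = ‖(X v - ω * Y v) + ω * Y v‖ := by ring_nf
        _ ≤ ‖X v - ω * Y v‖ + ‖ω * Y v‖ := norm_add_le _ _
        _ ≤ 3 / 2 * ‖Y v‖ := by rw [hn]; linarith
    have hXp : 0 < ‖X v‖ := norm_pos_iff.2 hX
    rw [le_div_iff₀ (by positivity)]
    calc ‖X v - ω * Y v‖ * ‖X v‖ ^ 2 ≤ ‖X v - ω * Y v‖ * (3 / 2 * ‖Y v‖) ^ 2 := by gcongr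
      _ = 9 / 4 * (‖X v - ω * Y v‖ * ‖Y v‖ ^ 2) := by ring
      _ ≤ c := by rw [hc]; linarith [norm_nonneg δ]
  set K : ℝ := 2304 * κ * c ^ 2 + 2 / ‖s‖ with hK
  have hsp : 0 < ‖s‖ := norm_pos_iff.2 hs
  have hKs : 1 < K * ‖s‖ := by
    rw [hK, add_mul, div_mul_cancel₀ _ hsp.ne']
    have : 0 ≤ 2304 * κ * c ^ 2 * ‖s‖ := by positivity
    linarith
  have hfinω (ω : ℂ) (hω : ω ^ 3 = 1) : {v ∈ S | ‖X v - ω * Y v‖ ≤ ‖Y v‖ / 2}.Finite := by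
    by_contra hinf
    have hlarge (B : ℝ) : ∃ v ∈ S, ‖X v - ω * Y v‖ ≤ ‖Y v‖ / 2 ∧ B < ‖X v‖ := by
      obtain ⟨v, hv, hvB⟩ := (Set.Infinite.sdiff hinf (hfinX B)).nonempty
      exact ⟨v, hv.1, hv.2, by by_contra! h; exact hvB ⟨hv.1, h⟩⟩
    obtain ⟨v, hv, hvω, hvB⟩ := hlarge (max (K ^ 9) 0)
    obtain ⟨w, hw, hwω, hwB⟩ := hlarge (max (‖X v‖ ^ 10) 0)
    have hX : X v ≠ 0 := norm_pos_iff.1 ((le_max_right _ _).trans_lt hvB)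
    have hXw : X w ≠ 0 := norm_pos_iff.1 ((le_max_right _ _).trans_lt hwB)
    have hY : Y v ≠ 0 := by
      intro hY
      rw [hY, mul_zero, sub_zero, norm_zero, zero_div] at hvω
      exact hX (norm_le_zero_iff.1 hvω)
    have hlt := norm_lt_of_norm_sub_le hd hκ hc1 (K := K)
      (by rw [hK]; linarith [show 0 < 2 / ‖s‖ by positivity]) hKs hω
      (X := X v) (Y := Y v) (X' := X w) (Y' := Y w)
      (by rw [← sub_ne_zero, show X v ^ 3 - Y v ^ 3 = δ from hv]; exact hδ) hY
      ((le_max_left _ _).trans hvB.le) (happrox ω hω v hv hX hvω) (happrox ω hω w hw hXw hwω)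
      (hcube v.1 v.2) (hmix v.1 v.2 w.1 w.2)
    exact absurd ((le_max_left _ _).trans_lt hwB) hlt.not_gt
  have hfinY : {v ∈ S | ‖Y v‖ ^ 3 ≤ 8 * ‖δ‖}.Finite := by
    refine (hfinX (9 * ‖δ‖ + 1)).subset fun v hv => ⟨hv.1, ?_⟩
    have e : X v ^ 3 = Y v ^ 3 + δ := by rw [← show X v ^ 3 - Y v ^ 3 = δ from hv.1]; ring
    have h1 : ‖X v‖ ^ 3 ≤ ‖Y v‖ ^ 3 + ‖δ‖ := by
      rw [← norm_pow, e, ← norm_pow]; exact norm_add_le _ _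
    have h2 : 9 * ‖δ‖ + 1 ≤ (9 * ‖δ‖ + 1) ^ 3 :=
      le_self_pow₀ (by linarith [norm_nonneg δ]) (by norm_num)
    exact le_of_pow_le_pow_left₀ (n := 3) (by norm_num) (by positivity) (by linarith [hv.2])
  refine (((Finset.range 3).finite_toSet.biUnion fun i _ =>
    hfinω (ζ ^ i) (by rw [← pow_mul, mul_comm, pow_mul, hζ3, one_pow])).union hfinY).subset ?_
  intro v hv
  by_cases hY : ‖Y v‖ ^ 3 ≤ 8 * ‖δ‖
  · exact Or.inr ⟨hv, hY⟩
  · obtain ⟨i, hi, hle⟩ := exists_cube_root_near (X := X v) (Y := Y v)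
      (by rw [show X v ^ 3 - Y v ^ 3 = δ from hv]; exact not_le.1 hY) hζ
    exact Or.inl (Set.mem_biUnion hi ⟨hv, hle⟩)

lemma ConjPair.one_two_mul (m n : ℤ) : ConjPair 1 (2 * m) (2 * n) :=
  ⟨m + n, m - n, by push_cast; ring, by push_cast; ring⟩

lemma finite_cubic_eq_of_ne_zero {a b c m : ℤ} (hb : b ≠ 0) (hc : c ≠ 0)
    (hdisc : 4 * b ^ 3 + 27 * a ^ 2 * c ≠ 0) (hm : m ≠ 0) :
    {v : ℤ × ℤ | a * v.1 ^ 3 + b * v.1 ^ 2 * v.2 + c * v.2 ^ 3 = m}.Finite := by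
  obtain ⟨s, hs⟩ := IsAlgClosed.exists_pow_nat_eq
    (3 * c * (4 * b ^ 3 + 27 * a ^ 2 * c) : ℂ) (n := 2) (by norm_num)
  have hd : s ^ 2 = ((3 * c * (4 * b ^ 3 + 27 * a ^ 2 * c) : ℤ) : ℂ) := by rw [hs]; push_cast; ring
  have hs0 : s ≠ 0 := by
    rintro rfl
    rw [zero_pow two_ne_zero] at hd
    exact mul_ne_zero (mul_ne_zero three_ne_zero hc) hdisc (by exact_mod_cast hd.symm)
  have hb' : (b : ℂ) ≠ 0 := by exact_mod_cast hb
  obtain ⟨x, hx⟩ := IsAlgClosed.exists_pow_nat_eq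
    ((-2 * b ^ 3 - 27 * a ^ 2 * c + 3 * a * s) / 2 : ℂ) (n := 3) (by norm_num)
  have hprod : (-2 * b ^ 3 - 27 * a ^ 2 * c + 3 * a * s) / 2 *
      ((-2 * b ^ 3 - 27 * a ^ 2 * c - 3 * a * s) / 2) = (b ^ 6 : ℂ) := by
    linear_combination (-9 / 4 * a ^ 2 : ℂ) * hs
  have hx0 : x ≠ 0 := by
    rintro rfl
    rw [← hx, zero_pow three_ne_zero, zero_mul] at hprod
    exact pow_ne_zero 6 hb' hprod.symm
  obtain ⟨y, hxy⟩ : ∃ y, x * y = b ^ 2 := ⟨b ^ 2 / x, mul_div_cancel₀ _ hx0⟩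
  have hy : y ^ 3 = (-2 * b ^ 3 - 27 * a ^ 2 * c - 3 * a * s) / 2 := by
    apply mul_left_cancel₀ (pow_ne_zero 3 hx0)
    rw [← mul_pow, hxy, hx, hprod]
    ring
  obtain ⟨r, hr⟩ : ∃ r : ℂ, 2 * b ^ 2 * r = 9 * a * c + s :=
    ⟨(9 * a * c + s) / (2 * b ^ 2), by field_simp⟩
  obtain ⟨t, ht⟩ : ∃ t : ℂ, 2 * b ^ 2 * t = 9 * a * c - s :=
    ⟨(9 * a * c - s) / (2 * b ^ 2), by field_simp⟩
  have hκ : (((16 * b ^ 6).natAbs : ℕ) : ℂ) = 16 * b ^ 6 := by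
    rw [← Int.cast_natCast, Int.natAbs_of_nonneg (by positivity)]
    push_cast
    rfl
  have hpair (p q : ℤ) : ConjPair s (2 * b ^ 2 * p - 2 * b ^ 2 * r * q)
      (2 * b ^ 2 * p - 2 * b ^ 2 * t * q) := by
    rw [hr, ht]
    exact ⟨2 * b ^ 2 * p - 9 * a * c * q, -q, by push_cast; ring, by push_cast; ring⟩
  have hcoeff : ConjPair s (2 * x ^ 3) (2 * y ^ 3) := by
    rw [hx, hy]
    exact ⟨-2 * b ^ 3 - 27 * a ^ 2 * c, 3 * a, by push_cast; ring, by push_cast; ring⟩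
  refine (finite_cube_sub_cube_eq hs0 hd (κ := (16 * b ^ 6).natAbs)
    (Int.natAbs_pos.2 (by positivity)) (x₁ := x) (x₂ := -(x * r)) (y₁ := y) (y₂ := -(y * t))
    (δ := 3 * s * m) ?_ ?_ ?_ ?_).subset ?_
  · have : x * -(y * t) - -(x * r) * y = s := by
      linear_combination (r - t) * hxy + hr / 2 - ht / 2
    rwa [this]
  · exact mul_ne_zero (mul_ne_zero three_ne_zero hs0) (by exact_mod_cast hm)
  · intro p q
    rw [hκ]
    convert hcoeff.mul hd ((hpair p q).pow hd 3) using 1 <;> ring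
  · intro p q p' q'
    rw [hκ]
    convert ((hpair p' q').mul hd (hpair p q).symm).int_mul (4 * b ^ 4) using 1
    · push_cast
      linear_combination (16 * b ^ 6 * (p' - r * q') * (p - t * q) : ℂ) * hxy
    · push_cast
      linear_combination (16 * b ^ 6 * (p' - t * q') * (p - r * q) : ℂ) * hxy
  · rintro ⟨p, q⟩ hv
    have hv' : (a * p ^ 3 + b * p ^ 2 * q + c * q ^ 3 : ℂ) = m := by
      exact_mod_cast show a * p ^ 3 + b * p ^ 2 * q + c * q ^ 3 = m from hv
    have hb6 : (8 * b ^ 6 : ℂ) ≠ 0 := mul_ne_zero (by norm_num) (pow_ne_zero 6 hb')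
    refine mul_left_cancel₀ hb6 ?_
    have e1 : (8 * b ^ 6 * (x * p + -(x * r) * q) ^ 3 : ℂ) =
        x ^ 3 * (2 * b ^ 2 * p - 2 * b ^ 2 * r * q) ^ 3 := by ring
    have e2 : (8 * b ^ 6 * (y * p + -(y * t) * q) ^ 3 : ℂ) =
        y ^ 3 * (2 * b ^ 2 * p - 2 * b ^ 2 * t * q) ^ 3 := by ring
    rw [mul_sub, e1, e2, hx, hy, hr, ht, ← hv']
    linear_combination (s * (9 * a * (2 * b ^ 2 * p - 9 * a * c * q) * q ^ 2 -
      (-2 * b ^ 3 - 27 * a ^ 2 * c) * q ^ 3) : ℂ) * hs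

lemma finite_diagonal_cubic_eq {a c m : ℤ} (ha : a ≠ 0) (hc : c ≠ 0) (hm : m ≠ 0) :
    {v : ℤ × ℤ | a * v.1 ^ 3 + c * v.2 ^ 3 = m}.Finite := by
  have ha' : (a : ℂ) ≠ 0 := by exact_mod_cast ha
  have hc' : (c : ℂ) ≠ 0 := by exact_mod_cast hc
  have hm' : (m : ℂ) ≠ 0 := by exact_mod_cast hm
  obtain ⟨x, hx⟩ := IsAlgClosed.exists_pow_nat_eq (27 * a ^ 2 * c : ℂ) (n := 3) (by norm_num)
  have hx0 : x ≠ 0 := by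
    rintro rfl
    have : (27 * a ^ 2 * c : ℂ) ≠ 0 := by simp [ha', hc']
    exact this (by rw [← hx, zero_pow three_ne_zero])
  obtain ⟨y, hxy⟩ : ∃ y, x * y = -9 * a * c := ⟨-9 * a * c / x, mul_div_cancel₀ _ hx0⟩
  have hy : y ^ 3 = -27 * a * c ^ 2 := by
    apply mul_left_cancel₀ (pow_ne_zero 3 hx0)
    rw [← mul_pow, hxy, hx]
    ring
  refine (finite_cube_sub_cube_eq (s := 1) (d := 1) one_ne_zero (by simp) (κ := 2) two_pos
    (x₁ := x) (x₂ := 0) (y₁ := 0) (y₂ := y) (δ := 27 * a * c * m) ?_ ?_ ?_ ?_).subset ?_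
  · rw [zero_mul, sub_zero, hxy]
    exact mul_ne_zero (mul_ne_zero (by norm_num) ha') hc'
  · exact mul_ne_zero (mul_ne_zero (mul_ne_zero (by norm_num) ha') hc') hm'
  · intro p q
    convert ConjPair.one_two_mul (27 * a ^ 2 * c * p ^ 3) (-27 * a * c ^ 2 * q ^ 3) using 1
    · push_cast
      linear_combination (2 * p ^ 3 : ℂ) * hx
    · push_cast
      linear_combination (2 * q ^ 3 : ℂ) * hy
  · intro p q p' q'
    convert ConjPair.one_two_mul (-9 * a * c * p' * q) (-9 * a * c * p * q') using 1
    · push_cast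
      linear_combination (2 * p' * q : ℂ) * hxy
    · push_cast
      linear_combination (2 * p * q' : ℂ) * hxy
  · rintro ⟨p, q⟩ hv
    have hv' : (a * p ^ 3 + c * q ^ 3 : ℂ) = m := by
      exact_mod_cast show a * p ^ 3 + c * q ^ 3 = m from hv
    change (x * p + 0 * q) ^ 3 - (0 * p + y * q) ^ 3 = 27 * a * c * (m : ℂ)
    linear_combination (27 * a * c : ℂ) * hv' + (p ^ 3 : ℂ) * hx - (q ^ 3 : ℂ) * hy

/-- The Thue theorem for binary cubic forms without `x * y ^ 2` term and nonzero discriminant. -/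
theorem finite_cubic_eq {a b c m : ℤ} (hc : c ≠ 0) (hdisc : 4 * b ^ 3 + 27 * a ^ 2 * c ≠ 0)
    (hm : m ≠ 0) :
    {v : ℤ × ℤ | a * v.1 ^ 3 + b * v.1 ^ 2 * v.2 + c * v.2 ^ 3 = m}.Finite := by
  rcases eq_or_ne b 0 with rfl | hb
  · have ha : a ≠ 0 := by rintro rfl; simp at hdisc
    simpa using finite_diagonal_cubic_eq ha hc hm
  · exact finite_cubic_eq_of_ne_zero hb hc hdisc hm

/-- The substitution `x ↦ p x + r y`, `y ↦ q x + t y` of determinant one carries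
`a x ^ 3 + b x ^ 2 y + c y ^ 3` to `a' x ^ 3 + b' x ^ 2 y + c' y ^ 3`. -/
structure IsCubicSubst (a b c a' b' c' p q r t : ℤ) : Prop where
  det_eq : p * t - r * q = 1
  coeff_xxx : a' = a * p ^ 3 + b * p ^ 2 * q + c * q ^ 3
  coeff_xxy : b' = 3 * a * p ^ 2 * r + b * (2 * p * r * q + p ^ 2 * t) + 3 * c * q ^ 2 * t
  coeff_xyy : 3 * a * p * r ^ 2 + b * (r ^ 2 * q + 2 * p * r * t) + 3 * c * q * t ^ 2 = 0
  coeff_yyy : c' = a * r ^ 3 + b * r ^ 2 * t + c * t ^ 3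

lemma isCubicSubst_of_matAct_eq {a b c a' b' c' : ℤ} {T : Matrix (Fin 2) (Fin 2) ℤ}
    (hT : T.det = 1)
    (h : matAct T (C a * X 0 ^ 3 + C b * X 0 ^ 2 * X 1 + C c * X 1 ^ 3) =
      C a' * X 0 ^ 3 + C b' * X 0 ^ 2 * X 1 + C c' * X 1 ^ 3) :
    IsCubicSubst a b c a' b' c' (T 0 0) (T 1 0) (T 0 1) (T 1 1) := by
  have heval (x y : ℤ) :
      a * (T 0 0 * x + T 0 1 * y) ^ 3 +
        b * (T 0 0 * x + T 0 1 * y) ^ 2 * (T 1 0 * x + T 1 1 * y) +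
        c * (T 1 0 * x + T 1 1 * y) ^ 3 = a' * x ^ 3 + b' * x ^ 2 * y + c' * y ^ 3 := by
    simpa [matAct, Fin.sum_univ_two] using congrArg (eval ![x, y]) h
  rw [Matrix.det_fin_two] at hT
  have h10 := heval 1 0
  have h01 := heval 0 1
  have h11 := heval 1 1
  have h1n := heval 1 (-1)
  refine ⟨hT, ?_, ?_, ?_, ?_⟩ <;> linarith

namespace IsCubicSubst

variable {a b c a' b' c' p q r t : ℤ}

lemma disc_eq (h : IsCubicSubst a b c a' b' c' p q r t) :
    c' * (4 * b' ^ 3 + 27 * a' ^ 2 * c') = c * (4 * b ^ 3 + 27 * a ^ 2 * c) := by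
  have key (A B E D : ℤ) (hA : A = a * p ^ 3 + b * p ^ 2 * q + c * q ^ 3)
      (hB : B = 3 * a * p ^ 2 * r + b * (2 * p * r * q + p ^ 2 * t) + 3 * c * q ^ 2 * t)
      (hE : E = 3 * a * p * r ^ 2 + b * (r ^ 2 * q + 2 * p * r * t) + 3 * c * q * t ^ 2)
      (hD : D = a * r ^ 3 + b * r ^ 2 * t + c * t ^ 3) :
      B ^ 2 * E ^ 2 - 4 * A * E ^ 3 - 4 * B ^ 3 * D - 27 * A ^ 2 * D ^ 2 + 18 * A * B * E * D =
        -(c * (4 * b ^ 3 + 27 * a ^ 2 * c)) * (p * t - r * q) ^ 6 := by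
    subst hA hB hE hD
    ring
  have := key a' b' 0 c' h.coeff_xxx h.coeff_xxy h.coeff_xyy.symm h.coeff_yyy
  rw [h.det_eq] at this
  linarith

lemma hessian_eq (h : IsCubicSubst a b c a' b' c' p q r t) :
    b ^ 2 = b' ^ 2 * t ^ 2 + 9 * a' * c' * t * q - 3 * b' * c' * q ^ 2 := by
  have key (A B E D : ℤ) (hA : A = a * p ^ 3 + b * p ^ 2 * q + c * q ^ 3)
      (hB : B = 3 * a * p ^ 2 * r + b * (2 * p * r * q + p ^ 2 * t) + 3 * c * q ^ 2 * t)
      (hE : E = 3 * a * p * r ^ 2 + b * (r ^ 2 * q + 2 * p * r * t) + 3 * c * q * t ^ 2)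
      (hD : D = a * r ^ 3 + b * r ^ 2 * t + c * t ^ 3) :
      (B ^ 2 - 3 * A * E) * t ^ 2 - (B * E - 9 * A * D) * t * q + (E ^ 2 - 3 * B * D) * q ^ 2 =
        b ^ 2 * (p * t - r * q) ^ 4 := by
    subst hA hB hE hD
    ring
  have := key a' b' 0 c' h.coeff_xxx h.coeff_xxy h.coeff_xyy.symm h.coeff_yyy
  rw [h.det_eq] at this
  linarith

lemma unique {a'' b'' c'' p' q' : ℤ} (h : IsCubicSubst a b c a' b' c' p q r t)
    (h' : IsCubicSubst a b c a'' b'' c'' p' q' r t) (hc' : c' ≠ 0) :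
    (a', b', c') = (a'', b'', c'') := by
  obtain ⟨k, hk⟩ : ∃ k, k = p * q' - q * p' := ⟨_, rfl⟩
  have hp : p' = p + k * r := by
    linear_combination -r * hk - p' * h.det_eq + p * h'.det_eq
  have hq : q' = q + k * t := by
    linear_combination -t * hk - q' * h.det_eq + q * h'.det_eq
  have hk0 : k = 0 := by
    have : c' * k = 0 := by
      have h1 := h.coeff_xyy
      have h2 := h'.coeff_xyy
      rw [hp, hq] at h2
      linarith [congrArg (· * k) h.coeff_yyy]
    exact (mul_eq_zero.1 this).resolve_left hc'
  rw [hk0, zero_mul, add_zero] at hp hq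
  rw [h.coeff_xxx, h.coeff_xxy, h.coeff_yyy, h'.coeff_xxx, h'.coeff_xxy, h'.coeff_yyy, hp, hq]

end IsCubicSubst

lemma finite_setOf_int_dvd {n : ℤ} (hn : n ≠ 0) : {m : ℤ | m ∣ n}.Finite := by
  refine (Set.finite_Icc (-|n|) |n|).subset fun m hm => abs_le.1 ?_
  exact Int.le_of_dvd (abs_pos.2 hn) ((abs_dvd_abs m n).2 hm)

lemma finite_isCubicSubst_of_disc_ne_zero {a b c : ℤ} (hc : c ≠ 0)
    (hdisc : 4 * b ^ 3 + 27 * a ^ 2 * c ≠ 0) :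
    {w : ℤ × ℤ × ℤ | w.2.2 ≠ 0 ∧
      ∃ p q r t, IsCubicSubst a b c w.1 w.2.1 w.2.2 p q r t}.Finite := by
  have hfin := ((finite_setOf_int_dvd (mul_ne_zero hc hdisc)).subset
    (Set.sep_subset _ fun m => m ≠ 0)).biUnion fun m hm => finite_cubic_eq hc hdisc hm.2
  refine (hfin.biUnion (t := fun v => {w : ℤ × ℤ × ℤ | w.2.2 ≠ 0 ∧
    ∃ p q, IsCubicSubst a b c w.1 w.2.1 w.2.2 p q v.1 v.2}) fun v _ =>
      Set.Subsingleton.finite ?_).subset ?_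
  · rintro ⟨a', b', c'⟩ ⟨hc', p, q, h⟩ ⟨a'', b'', c''⟩ ⟨-, p', q', h'⟩
    exact h.unique h' hc'
  · rintro ⟨a', b', c'⟩ ⟨hc', p, q, r, t, h⟩
    refine Set.mem_biUnion (x := (r, t)) ?_ ⟨hc', p, q, h⟩
    exact Set.mem_biUnion (x := c') ⟨⟨_, h.disc_eq.symm⟩, hc'⟩ h.coeff_yyy.symm

lemma finite_isCubicSubst_of_disc_eq_zero {a b c : ℤ} (hc : c ≠ 0)
    (hdisc : 4 * b ^ 3 + 27 * a ^ 2 * c = 0) :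
    {w : ℤ × ℤ × ℤ | w.2.2 ≠ 0 ∧
      ∃ p q r t, IsCubicSubst a b c w.1 w.2.1 w.2.2 p q r t}.Finite := by
  rcases eq_or_ne b 0 with rfl | hb
  · have ha : a = 0 := by simpa [hc] using hdisc
    subst ha
    refine ((Set.finite_singleton 0).prod
      ((Set.finite_singleton 0).prod (finite_setOf_int_dvd hc))).subset ?_
    rintro ⟨a', b', c'⟩ ⟨hc', p, q, r, t, h⟩
    have hyyy := h.coeff_yyy
    have ht : t ≠ 0 := by
      rintro rfl
      exact hc' (by simpa using hyyy)
    have hq : q = 0 := by simpa [hc, ht] using h.coeff_xyy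
    subst hq
    have hpt : p * t = 1 := by simpa using h.det_eq
    refine ⟨by simpa using h.coeff_xxx, by simpa using h.coeff_xxy, p ^ 3, ?_⟩
    rw [hyyy]
    linear_combination (-c * ((p * t) ^ 2 + p * t + 1)) * hpt
  · have h3b : 3 * b ^ 2 ≠ 0 := by positivity
    have hN : 4 * (3 * b ^ 2) ^ 3 ≠ 0 := by positivity
    refine ((finite_setOf_int_dvd hN).prod
      ((finite_setOf_int_dvd h3b).prod (finite_setOf_int_dvd hN))).subset ?_
    rintro ⟨a', b', c'⟩ ⟨hc', p, q, r, t, h⟩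
    have hdisc' : 4 * b' ^ 3 + 27 * a' ^ 2 * c' = 0 := by
      have := h.disc_eq
      rw [hdisc, mul_zero] at this
      exact (mul_eq_zero.1 this).resolve_left hc'
    have h27 : b' ∣ 27 * a' * c' := by
      rw [← Int.pow_dvd_pow_iff two_ne_zero]
      exact ⟨-108 * c' * b', by linear_combination 27 * c' * hdisc'⟩
    have hb' : b' ∣ 3 * b ^ 2 := by
      obtain ⟨k, hk⟩ := h27
      exact ⟨3 * b' * t ^ 2 + k * t * q - 9 * c' * q ^ 2, by
        linear_combination 3 * h.hessian_eq + t * q * hk⟩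
    have hb3 : 4 * b' ^ 3 ∣ 4 * (3 * b ^ 2) ^ 3 := mul_dvd_mul_left 4 (pow_dvd_pow_of_dvd hb' 3)
    exact ⟨.trans ⟨-27 * a' * c', by linear_combination hdisc'⟩ hb3, hb',
      .trans ⟨-27 * a' ^ 2, by linear_combination hdisc'⟩ hb3⟩

/-- Proposition 3.13. For a binary cubic form
`F = a·x³ + b·x²y + c·y³` with `c ≠ 0`, the set of triples `(a', b', c') ∈ ℤ³`
with `c' ≠ 0` such that some `T ∈ SL(2, ℤ)` gives
`T·F = a'·x³ + b'·x²y + c'·y³` is finite. -/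
theorem stmt7 (a b c : ℤ) (hc : c ≠ 0) (F : MvPolynomial (Fin 2) ℤ)
    (hF : F = C a * X 0 ^ 3 + C b * X 0 ^ 2 * X 1 + C c * X 1 ^ 3) :
    {p : ℤ × ℤ × ℤ | p.2.2 ≠ 0 ∧ ∃ T : Matrix (Fin 2) (Fin 2) ℤ, T.det = 1 ∧
      matAct T F =
        C p.1 * X 0 ^ 3 + C p.2.1 * X 0 ^ 2 * X 1 + C p.2.2 * X 1 ^ 3}.Finite := by
  have hfin : {w : ℤ × ℤ × ℤ | w.2.2 ≠ 0 ∧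
      ∃ p q r t, IsCubicSubst a b c w.1 w.2.1 w.2.2 p q r t}.Finite := by
    by_cases hdisc : 4 * b ^ 3 + 27 * a ^ 2 * c = 0
    · exact finite_isCubicSubst_of_disc_eq_zero hc hdisc
    · exact finite_isCubicSubst_of_disc_ne_zero hc hdisc
  refine hfin.subset ?_
  rintro w ⟨hw, T, hT, h⟩
  rw [hF] at h
  exact ⟨hw, _, _, _, _, isCubicSubst_of_matAct_eq hT h⟩
end
end
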